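/- arXiv:1408.5488 — 3 statements merged into one kernel-verified Lean document; each statement's English description precedes it below -/
import Mathlib

section
/- For k ≥ 2 and d ≥ ℓ ≥ 2, the weak saturation number wsat(P_k^d, C_{2ℓ}) equals k^d − 1. -/
open SimpleGraph Finset

def cube (d : ℕ) : SimpleGraph (Fin d → ZMod 2) :=
  SimpleGraph.fromRel (fun u v => ∃ i, u i ≠ v i ∧ ∀ j, j ≠ i → u j = v j)

def grid (k d : ℕ) : SimpleGraph (Fin d → Fin k) :=
  SimpleGraph.fromRel (fun u v => ∃ i, ((u i : ℕ)) + 1 = (v i : ℕ) ∧ ∀ j, j ≠ i → u j = v j)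

def CopyAt {α β : Type*} (H : SimpleGraph α) (G : SimpleGraph β) (u v : β) : Prop :=
  ∃ f : α → β, Function.Injective f ∧ (∀ ⦃a b⦄, H.Adj a b → G.Adj (f a) (f b)) ∧
    ∃ a b, H.Adj a b ∧ f a = u ∧ f b = v

def ContainsCopy {α β : Type*} (H : SimpleGraph α) (G : SimpleGraph β) : Prop :=
  ∃ f : α → β, Function.Injective f ∧ ∀ ⦃a b⦄, H.Adj a b → G.Adj (f a) (f b)

def WeaklySaturated {α β : Type*} (F G : SimpleGraph β) (H : SimpleGraph α) : Prop :=
  G ≤ F ∧ ∃ (n : ℕ) (seq : ℕ → SimpleGraph β), seq 0 = G ∧ seq n = F ∧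
    ∀ i < n, ∃ u v : β, ¬ (seq i).Adj u v ∧ F.Adj u v ∧
      seq (i + 1) = seq i ⊔ SimpleGraph.fromEdgeSet {s(u, v)} ∧
      CopyAt H (seq (i + 1)) u v

noncomputable def wsatNum {α β : Type*} (F : SimpleGraph β) (H : SimpleGraph α) : ℕ :=
  sInf {n | ∃ G, WeaklySaturated F G H ∧ G.edgeSet.ncard = n}

def Saturated {α β : Type*} (F G : SimpleGraph β) (H : SimpleGraph α) : Prop :=
  G ≤ F ∧ ¬ ContainsCopy H G ∧ ∀ u v : β, F.Adj u v → ¬ G.Adj u v →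
    ContainsCopy H (G ⊔ SimpleGraph.fromEdgeSet {s(u, v)})

noncomputable def satNum {α β : Type*} (F : SimpleGraph β) (H : SimpleGraph α) : ℕ :=
  sInf {n | ∃ G, Saturated F G H ∧ G.edgeSet.ncard = n}

set_option linter.unusedSimpArgs false


variable {V : Type*}

/-- Seeded closure rule: a path on `m` vertices through an `X`-edge, with all edges in `X ∪ T`,
closes up. -/
def SRule (F : SimpleGraph V) (S : Finset V) (m : ℕ) (T : Finset (Sym2 V)) (X : Set (Sym2 V)) : Prop :=
  ∀ (s : List V) (u v : V) (t : List V) (x y : V),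
    (∀ z ∈ s ++ u :: v :: t, z ∈ S) → (s ++ u :: v :: t).Nodup → (s ++ u :: v :: t).length = m →
    (s ++ u :: v :: t).IsChain (fun x y => F.Adj x y ∧ (s(x, y) ∈ X ∨ s(x, y) ∈ T)) →
    s(u, v) ∈ X → (s ++ u :: v :: t).head? = some x → (s ++ u :: v :: t).getLast? = some y →
    F.Adj x y → s(x, y) ∈ X

/-- The seeded percolation statement used for the cube. -/
def PP (F : SimpleGraph V) (S : Finset V) (m : ℕ) : Prop :=
  ∃ (T : Finset (Sym2 V)) (a b : V) (r : List V),
    T.card + 1 ≤ S.card ∧ (∀ e ∈ T, e ∈ F.edgeSet) ∧ (a :: b :: r).Nodup ∧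
    (∀ z ∈ a :: b :: r, z ∈ S) ∧ (a :: b :: r).length = m ∧
    (a :: b :: r).IsChain (fun x y => s(x, y) ∈ T) ∧
    (∀ z, (b :: r).getLast? = some z → F.Adj z a) ∧
    (∀ z ∈ S, ∃ y ∈ S, F.Adj z y) ∧
    ∀ X : Set (Sym2 V), s(a, b) ∈ X → SRule F S m T X →
      ∀ x ∈ S, ∀ y ∈ S, F.Adj x y → s(x, y) ∈ X

/-- Closure rule for paths on `m` vertices. -/
def CRule (F : SimpleGraph V) (m : ℕ) (X : Set (Sym2 V)) : Prop :=
  ∀ (p : List V) (x y : V), p.Nodup → p.length = m →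
    p.IsChain (fun x y => F.Adj x y ∧ s(x, y) ∈ X) →
    p.head? = some x → p.getLast? = some y → F.Adj x y → s(x, y) ∈ X

/-- The set `S` has a spanning tree percolating in `S`. -/
def QQ (F : SimpleGraph V) (S : Finset V) (m : ℕ) : Prop :=
  ∃ T : Finset (Sym2 V), T.card + 1 ≤ S.card ∧ (∀ e ∈ T, e ∈ F.edgeSet) ∧
    ∀ X : Set (Sym2 V), (∀ e ∈ T, e ∈ X) → CRule F m X →
      ∀ x ∈ S, ∀ y ∈ S, F.Adj x y → s(x, y) ∈ X

theorem QQ_of_PP {F : SimpleGraph V} {S : Finset V} {m : ℕ} (h : PP F S m) : QQ F S m := by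
  obtain ⟨T, a, b, r, h1, h2, h3, h4, h5, h6, h7, h8, h9⟩ := h
  refine ⟨T, h1, h2, fun X hT hX => h9 X (hT _ ?_) ?_⟩
  · simp at h6; exact h6.1
  · intro s u v t x y _ hn hl hc _ hh hg ha
    refine hX _ x y hn hl (hc.imp ?_) hh hg ha
    rintro p q ⟨h, h' | h'⟩
    · exact ⟨h, h'⟩
    · exact ⟨h, hT _ h'⟩

theorem QQ_step [DecidableEq V] {F : SimpleGraph V} {S S' L : Finset V} {u : V → V} {m : ℕ}
    (h : QQ F S (m + 2))
    (hS' : S' = S ∪ L.image u) (hu : ∀ x ∈ L, u x ∉ S)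
    (hinj : Set.InjOn u L) (hadj : ∀ x ∈ L, F.Adj x (u x))
    (hcl : ∀ x ∈ S', ∀ y ∈ S', F.Adj x y → (x ∈ S ∧ y ∈ S) ∨ (∃ z ∈ L, s(x, y) = s(z, u z)) ∨
      ∃ z ∈ L, ∃ w ∈ L, F.Adj z w ∧ s(x, y) = s(u z, u w))
    (hpath : ∀ x ∈ L, ∀ y ∈ L, F.Adj x y → ∃ p : List V, p.Nodup ∧ p.length = m ∧
      p.IsChain F.Adj ∧ p.head? = some x ∧ p.getLast? = some y ∧ ∀ z ∈ p, z ∈ S) :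
    QQ F S' (m + 2) := by
  obtain ⟨T, h1, h2, h3⟩ := h
  refine ⟨T ∪ L.image (fun x => s(x, u x)), ?_, ?_, ?_⟩
  · have e1 := card_union_le T (L.image (fun x => s(x, u x)))
    have e2 : (L.image (fun x => s(x, u x))).card ≤ L.card := card_image_le
    have e3 : S'.card = S.card + L.card := by
      rw [hS', card_union_of_disjoint, card_image_of_injOn hinj]
      rw [Finset.disjoint_right]
      intro x hx
      obtain ⟨z, hz, rfl⟩ := Finset.mem_image.1 hx
      exact hu z hz
    omega
  · intro e he
    rcases Finset.mem_union.1 he with he | he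
    · exact h2 e he
    · obtain ⟨z, hz, rfl⟩ := Finset.mem_image.1 he
      exact hadj z hz
  · intro X hT hX
    have hSX := h3 X (fun e he => hT e (Finset.mem_union_left _ he)) hX
    have hv : ∀ z ∈ L, s(z, u z) ∈ X := fun z hz =>
      hT _ (Finset.mem_union_right _ (Finset.mem_image_of_mem _ hz))
    intro x hx y hy hxy
    rcases hcl x hx y hy hxy with ⟨hx, hy⟩ | ⟨z, hz, e⟩ | ⟨z, hz, w, hw, hzw, e⟩
    · exact hSX x hx y hy hxy
    · rw [e]; exact hv z hz
    · have hxy' : F.Adj (u z) (u w) := by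
        rw [← SimpleGraph.mem_edgeSet, ← e]; exact hxy
      rw [e]
      obtain ⟨p, hn, hl, hc, hh, hg, hpS⟩ := hpath z hz w hw hzw
      refine hX (u z :: (p ++ [u w])) (u z) (u w) ?_ ?_ ?_ ?_ ?_ hxy'
      · have : u z ≠ u w := hxy'.ne
        have h1 : u z ∉ p := fun h => hu z hz (hpS _ h)
        have h2 : u w ∉ p := fun h => hu w hw (hpS _ h)
        simp [List.nodup_append, hn, this, h1]
        rintro a ha rfl; exact h2 ha
      · simp [hl]
      · have hc' : p.IsChain (fun x y => F.Adj x y ∧ s(x, y) ∈ X) := by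
          rw [List.isChain_iff_getElem] at hc ⊢
          intro i hi
          exact ⟨hc i hi, hSX _ (hpS _ (List.getElem_mem _)) _ (hpS _ (List.getElem_mem _)) (hc i hi)⟩
        rw [List.isChain_cons, List.isChain_append]
        refine ⟨?_, hc', by simp, ?_⟩
        · intro y hy
          have : y = z := by
            cases p <;> simp_all
          subst this
          exact ⟨(hadj y hz).symm, by rw [Sym2.eq_swap]; exact hv y hz⟩
        · intro a ha b hb
          have : a = w := by simp_all
          subst this
          have : b = u a := by simp_all
          subst this
          exact ⟨hadj a hw, hv a hw⟩
      · simp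
      · rw [List.getLast?_cons, List.getLast?_append]; simp

theorem chain_head {R : V → V → Prop} {l : List V} {x y : V} (hl : l.IsChain R)
    (hh : l.head? = some x) (h : R y x) : (y :: l).IsChain R := by
  rw [List.isChain_cons]
  refine ⟨fun z hz => ?_, hl⟩
  rw [hh] at hz
  cases hz; exact h

theorem chain_last {R : V → V → Prop} {l : List V} {x y : V} (hl : l.IsChain R)
    (hh : l.getLast? = some x) (h : R x y) : (l ++ [y]).IsChain R := by
  rw [List.isChain_append]
  refine ⟨hl, by simp, fun z hz w hw => ?_⟩
  rw [hh] at hz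
  cases hz; cases hw; exact h

theorem chain_join {R : V → V → Prop} {l l' : List V} {x y : V} (hl : l.IsChain R)
    (hl' : l'.IsChain R)
    (hh : l.getLast? = some x) (hh' : l'.head? = some y) (h : R x y) : (l ++ l').IsChain R := by
  rw [List.isChain_append]
  refine ⟨hl, hl', fun z hz w hw => ?_⟩
  rw [hh] at hz
  rw [hh'] at hw
  cases hz; cases hw; exact h

theorem mix [DecidableEq V] {S S' : Finset V} {u : V → V}
    (hSS : ∀ x ∈ S, x ∈ S') (huS : ∀ x ∈ S, u x ∈ S') (hu : ∀ x ∈ S, u x ∉ S)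
    (hinj : Set.InjOn u S) {c : List V} (hn : c.Nodup) (hS : ∀ z ∈ c, z ∈ S) (p q w : List V)
    (hp : ∀ x, p.count x ≤ c.count x) (hq : ∀ x, q.count x ≤ c.count x)
    (hw : ∀ x, w.count x = p.count x + (q.map u).count x) :
    (∀ z ∈ w, z ∈ S') ∧ w.Nodup := by
  have hc := List.nodup_iff_count_le_one.1 hn
  have hpn : p.Nodup := List.nodup_iff_count_le_one.2 fun x => (hp x).trans (hc x)
  have hqn : q.Nodup := List.nodup_iff_count_le_one.2 fun x => (hq x).trans (hc x)
  have hpS : ∀ z ∈ p, z ∈ S := fun z hz =>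
    hS z (List.count_pos_iff.1 ((List.count_pos_iff.2 hz).trans_le (hp z)))
  have hqS : ∀ z ∈ q, z ∈ S := fun z hz =>
    hS z (List.count_pos_iff.1 ((List.count_pos_iff.2 hz).trans_le (hq z)))
  have hperm : w.Perm (p ++ q.map u) := List.perm_iff_count.2 fun x => by
    rw [List.count_append]; exact hw x
  constructor
  · intro z hz
    rcases List.mem_append.1 (hperm.mem_iff.1 hz) with h | h
    · exact hSS z (hpS z h)
    · obtain ⟨y, hy, rfl⟩ := List.mem_map.1 h
      exact huS y (hqS y hy)
  · rw [hperm.nodup_iff, List.nodup_append]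
    refine ⟨hpn, (List.nodup_map_iff_inj_on hqn).2 fun x hx y hy h => hinj (hqS x hx) (hqS y hy) h, ?_⟩
    rintro x hx y hy rfl
    obtain ⟨z, hz, rfl⟩ := List.mem_map.1 hy
    exact hu z (hqS z hz) (hpS _ hx)

/-- The seed of the new percolation: the first cycle percolates to both layers. -/
theorem seed_step {F : SimpleGraph V} {S S' : Finset V} {u : V → V} {m : ℕ}
    {T' : Finset (Sym2 V)} {X : Set (Sym2 V)}
    (hSS : ∀ x ∈ S, x ∈ S') (huS : ∀ x ∈ S, u x ∈ S') (hu : ∀ x ∈ S, u x ∉ S)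
    (hinj : Set.InjOn u S) (hadj : ∀ x ∈ S, F.Adj x (u x))
    (hhom : ∀ x ∈ S, ∀ y ∈ S, F.Adj x y → F.Adj (u x) (u y))
    (hX : SRule F S' (m + 2) T' X) (hvT : ∀ x ∈ S, s(x, u x) ∈ T')
    {a b : V} {r : List V} (hn : (a :: b :: r).Nodup) (hS : ∀ z ∈ a :: b :: r, z ∈ S)
    (hlen : (a :: b :: r).length = m) (hab : F.Adj a b)
    (hc : (b :: r).IsChain (fun x y => F.Adj x y ∧ s(x, y) ∈ T'))
    (hf : s(u a, u b) ∈ T')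
    (hlast : ∀ z, (b :: r).getLast? = some z → F.Adj z a)
    (hseed : s(a, u a) ∈ X) :
    s(a, b) ∈ X ∧ s(u a, u b) ∈ X ∧ s(b, u b) ∈ X := by
  classical
  set R : V → V → Prop := fun x y => F.Adj x y ∧ (s(x, y) ∈ X ∨ s(x, y) ∈ T') with hR
  have hRs : ∀ {x y}, R x y → R y x := by
    intro x y h
    simpa only [hR, F.adj_comm y x, Sym2.eq_swap (a := y) (b := x)] using h
  have haS : a ∈ S := hS a (by simp)
  have hbS : b ∈ S := hS b (by simp)
  have hrS : ∀ z ∈ r, z ∈ S := fun z hz => hS z (by simp [hz])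
  have hvR : ∀ x ∈ S, R x (u x) := fun x hx => ⟨hadj x hx, Or.inr (hvT x hx)⟩
  have hcR : (b :: r).IsChain R := hc.imp fun x y h => ⟨h.1, Or.inr h.2⟩
  have huab : R (u a) (u b) := ⟨hhom a haS b hbS hab, Or.inr hf⟩
  have hinj' : ∀ {x y}, x ∈ S → y ∈ S → u x = u y → x = y := fun hx hy h => hinj hx hy h
  have hne : ∀ {x y}, x ∈ S → y ∈ S → x ≠ u y := fun hx hy h => hu _ hy (h ▸ hx)
  obtain ⟨w, hw⟩ : ∃ w, (b :: r).getLast? = some w := by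
    rw [List.getLast?_eq_some_getLast (by simp)]; exact ⟨_, rfl⟩
  have hwS : w ∈ S := hS w (List.mem_cons_of_mem _ (List.mem_of_getLast? hw))
  have hwa := hlast w hw
  have hrn : r.Nodup := by simp at hn; exact hn.2.2
  have hurn : (r.map u).Nodup := (List.nodup_map_iff_inj_on hrn).2
    fun x hx y hy h => hinj' (hrS x hx) (hrS y hy) h
  have h1 : s(w, a) ∈ X := by
    rw [Sym2.eq_swap]
    have hmix := mix hSS huS hu hinj hn hS (a :: b :: r) ([a, b]) ([] ++ a :: (u a) :: (u b :: b :: r))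
      (fun x => by simp only [List.count_append, List.count_cons, List.map_cons, List.map_append, List.count_nil, List.map_nil]; omega)
      (fun x => by simp only [List.count_append, List.count_cons, List.map_cons, List.map_append, List.count_nil, List.map_nil]; omega)
      (fun x => by simp only [List.count_append, List.count_cons, List.map_cons, List.map_append, List.count_nil, List.map_nil]; omega)
    refine hX [] a (u a) (u b :: b :: r) a w hmix.1 hmix.2 ?_ ?_ hseed (by simp) ?_ hwa.symm
    · simp at hlen ⊢; omega
    · exact chain_head (chain_head (chain_head hcR (by simp) (hRs (hvR b hbS))) (by simp) huab)
        (by simp [List.getLast?_cons]) (hvR a haS)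
    · simpa using hw
  have hcR2 : (b :: r ++ [a]).IsChain R := chain_last hcR hw ⟨hwa, Or.inl h1⟩
  have h2 : s(u a, u b) ∈ X := by
    rw [Sym2.eq_swap]
    have hmix := mix hSS huS hu hinj hn hS (a :: b :: r) ([a, b]) ((u b :: b :: r) ++ a :: (u a) :: [])
      (fun x => by simp only [List.count_append, List.count_cons, List.map_cons, List.map_append, List.count_nil, List.map_nil]; omega)
      (fun x => by simp only [List.count_append, List.count_cons, List.map_cons, List.map_append, List.count_nil, List.map_nil]; omega)
      (fun x => by simp only [List.count_append, List.count_cons, List.map_cons, List.map_append, List.count_nil, List.map_nil]; omega)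
    refine hX (u b :: b :: r) a (u a) [] (u b) (u a) hmix.1 hmix.2 ?_ ?_ hseed (by simp) (by simp [List.getLast?_cons]) huab.1.symm
    · simp at hlen ⊢; omega
    · have := chain_last (chain_head hcR2 (by simp) (hRs (hvR b hbS))) (by simp [List.getLast?_cons]) (hvR a haS)
      simpa using this
  have h3 : s(b, u b) ∈ X := by
    have hmix := mix hSS huS hu hinj hn hS (a :: b :: r) ([a, b]) ((b :: r) ++ a :: (u a) :: [u b])
      (fun x => by simp only [List.count_append, List.count_cons, List.map_cons, List.map_append, List.count_nil, List.map_nil]; omega)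
      (fun x => by simp only [List.count_append, List.count_cons, List.map_cons, List.map_append, List.count_nil, List.map_nil]; omega)
      (fun x => by simp only [List.count_append, List.count_cons, List.map_cons, List.map_append, List.count_nil, List.map_nil]; omega)
    refine hX (b :: r) a (u a) [u b] b (u b) hmix.1 hmix.2 ?_ ?_ hseed (by simp) (by simp [List.getLast?_cons]) (hadj b hbS)
    · simp at hlen ⊢; omega
    · have := chain_last (chain_last hcR2 (by simp [List.getLast?_cons]) (hvR a haS)) (by simp [List.getLast?_cons]) huab
      simpa using this
  refine ⟨?_, h2, h3⟩
  rcases r with _ | ⟨c, r'⟩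
  · simp at hw; subst hw; rwa [Sym2.eq_swap]
  have key : ∀ s t, c :: r' = s ++ t → ((b :: s).map u).IsChain R := by
    intro s
    induction s using List.reverseRecOn with
    | nil => intro t _; simp
    | append_singleton s z ih =>
      intro t hst
      have ih' := ih (z :: t) (by simp [hst])
      have hzS : z ∈ S := hrS z (by rw [hst]; simp)
      have hsub : ∀ y ∈ c :: r', y ∈ s ∨ y = z ∨ y ∈ t := by
        intro y hy; rw [hst] at hy; simpa [or_assoc] using hy
      have hsS : ∀ y ∈ s, y ∈ S := fun y hy => hrS y (by rw [hst]; simp [hy])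
      have htS : ∀ y ∈ t, y ∈ S := fun y hy => hrS y (by rw [hst]; simp [hy])
      obtain ⟨q, hq⟩ : ∃ q, (b :: s).getLast? = some q := by
        rw [List.getLast?_eq_some_getLast (by simp)]; exact ⟨_, rfl⟩
      have hqS : q ∈ S := by
        have := List.mem_of_getLast? hq
        simp at this; rcases this with rfl | h
        · exact hbS
        · exact hsS q h
      have hbig : (b :: s ++ z :: t ++ [a]).IsChain R := by
        have := hcR2; rw [hst] at this; simpa using this
      rw [List.append_assoc, List.isChain_append] at hbig
      have hqz : F.Adj q z := (hbig.2.2 q (by rw [hq]; simp) z (by simp)).1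
      have hzq : s(u z, u q) ∈ X := by
        have hmix := mix hSS huS hu hinj hn hS (z :: t ++ [a]) (z :: a :: b :: s) ((u z :: z :: t) ++ a :: (u a) :: ((b :: s).map u))
          (fun x => by rw [hst]; simp only [List.count_append, List.count_cons, List.map_cons, List.map_append, List.count_nil, List.map_nil]; omega)
          (fun x => by rw [hst]; simp only [List.count_append, List.count_cons, List.map_cons, List.map_append, List.count_nil, List.map_nil]; omega)
          (fun x => by simp only [List.count_append, List.count_cons, List.map_cons, List.map_append, List.count_nil, List.map_nil]; omega)
        refine hX (u z :: z :: t) a (u a) ((b :: s).map u) (u z) (u q) hmix.1 hmix.2 ?_ ?_ hseed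
          (by simp) ?_ (hhom q hqS z hzS hqz).symm
        · rw [hst] at hlen; simp at hlen ⊢; omega
        · have e1 := chain_head hbig.2.1 (by simp) (hRs (hvR z hzS))
          have e2 := chain_head ih' (by simp [List.getLast?_cons]) huab
          have := chain_join e1 e2 (x := a) (y := u a) (by simp [List.getLast?_cons]) (by simp [List.getLast?_cons]) (hvR a haS)
          simpa using this
        · have : ((b :: s).map u).getLast? = some (u q) := by rw [List.getLast?_map, hq]; rfl
          rw [List.getLast?_append, List.getLast?_cons, List.getLast?_cons, this]; rfl
      have : ((b :: s).map u ++ [u z]).IsChain R := by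
        refine chain_last ih' (x := u q) (by rw [List.getLast?_map, hq]; rfl) ?_
        exact ⟨hhom q hqS z hzS hqz, Or.inl (by rw [Sym2.eq_swap]; exact hzq)⟩
      simpa using this
  have hu1 := key (c :: r') [] (by simp)
  have hcS : c ∈ S := hrS c (by simp)
  have hulast : ((b :: c :: r').map u).getLast? = some (u w) := by rw [List.getLast?_map, hw]; rfl
  have hbc : R b c := by simp at hcR; exact hcR.1
  have hu1' : ((c :: r').map u).IsChain R := by
    simp only [List.map_cons, List.isChain_cons_cons] at hu1 ⊢; exact hu1.2
  have h4 : s(u a, u w) ∈ X := by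
    have hmix := mix hSS huS hu hinj hn hS ([b, c]) (a :: b :: c :: r') ([] ++ (u a) :: (u b) :: (b :: c :: (c :: r').map u))
      (fun x => by simp only [List.count_append, List.count_cons, List.map_cons, List.map_append, List.count_nil, List.map_nil]; omega)
      (fun x => by simp only [List.count_append, List.count_cons, List.map_cons, List.map_append, List.count_nil, List.map_nil]; omega)
      (fun x => by simp only [List.count_append, List.count_cons, List.map_cons, List.map_append, List.count_nil, List.map_nil]; omega)
    refine hX [] (u a) (u b) (b :: c :: (c :: r').map u) (u a) (u w) hmix.1 hmix.2 ?_ ?_ h2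
        (by simp) ?_ (hhom w hwS a haS hwa).symm
    · simp at hlen ⊢; omega
    · exact chain_head (chain_head (chain_head (chain_head hu1' (by simp) (hvR c hcS)) (by simp) hbc)
        (by simp) (hRs (hvR b hbS))) (by simp [List.getLast?_cons]) huab
    · simpa [List.getLast?_cons] using hulast
  have h5 : s(a, b) ∈ X := by
    rw [Sym2.eq_swap]
    have hmix := mix hSS huS hu hinj hn hS ([a, b]) (a :: b :: c :: r') ([] ++ b :: (u b) :: ((c :: r').map u ++ [u a, a]))
      (fun x => by simp only [List.count_append, List.count_cons, List.map_cons, List.map_append, List.count_nil, List.map_nil]; omega)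
      (fun x => by simp only [List.count_append, List.count_cons, List.map_cons, List.map_append, List.count_nil, List.map_nil]; omega)
      (fun x => by simp only [List.count_append, List.count_cons, List.map_cons, List.map_append, List.count_nil, List.map_nil]; omega)
    refine hX [] b (u b) ((c :: r').map u ++ [u a, a]) b a hmix.1 hmix.2 ?_ ?_ h3
        (by simp) (by simp [List.getLast?_cons]) hab.symm
    · simp at hlen ⊢; omega
    · have := chain_last (chain_last (chain_head hu1 (by simp) (hvR b hbS)) (y := u a) (x := u w)
        (by rw [List.getLast?_cons, hulast]; rfl)
        ⟨hhom w hwS a haS hwa, Or.inl (by rw [Sym2.eq_swap]; exact h4)⟩) (by simp [List.getLast?_cons]) (hRs (hvR a haS))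
      simpa using this
  exact h5

theorem PP_step [DecidableEq V] {F : SimpleGraph V} {S S' : Finset V} {u : V → V} {m : ℕ}
    (h : PP F S m) (hS' : S' = S ∪ S.image u) (hu : ∀ x ∈ S, u x ∉ S)
    (hinj : Set.InjOn u S) (hadj : ∀ x ∈ S, F.Adj x (u x))
    (hhom : ∀ x ∈ S, ∀ y ∈ S, F.Adj x y → F.Adj (u x) (u y))
    (hcl : ∀ x ∈ S', ∀ y ∈ S', F.Adj x y → (x ∈ S ∧ y ∈ S) ∨ (∃ z ∈ S, s(x, y) = s(z, u z)) ∨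
      ∃ z ∈ S, ∃ w ∈ S, F.Adj z w ∧ s(x, y) = s(u z, u w)) :
    PP F S' (m + 2) := by
  obtain ⟨T, a, b, r, h1, h2, h3, h4, h5, h6, h7, h8, h9⟩ := h
  have hSS : ∀ x ∈ S, x ∈ S' := fun x hx => by rw [hS']; exact Finset.mem_union_left _ hx
  have huS : ∀ x ∈ S, u x ∈ S' := fun x hx => by
    rw [hS']; exact Finset.mem_union_right _ (Finset.mem_image_of_mem _ hx)
  have haS : a ∈ S := h4 a (by simp)
  have hbS : b ∈ S := h4 b (by simp)
  have habT : s(a, b) ∈ T := by simp at h6; exact h6.1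
  have hab : F.Adj a b := h2 _ habT
  set W := S.image (fun x => s(x, u x)) with hW
  set T' := T.erase s(a, b) ∪ ({s(u a, u b)} ∪ W) with hT'
  have hvT : ∀ x ∈ S, s(x, u x) ∈ T' := fun x hx =>
    Finset.mem_union_right _ (Finset.mem_union_right _ (Finset.mem_image_of_mem _ hx))
  have hfT : s(u a, u b) ∈ T' := by simp [hT']
  have hTT : ∀ e ∈ T, e = s(a, b) ∨ e ∈ T' := by
    intro e he
    by_cases h : e = s(a, b)
    · exact Or.inl h
    · exact Or.inr (Finset.mem_union_left _ (Finset.mem_erase.2 ⟨h, he⟩))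
  have hbr : (b :: r).IsChain (fun x y => F.Adj x y ∧ s(x, y) ∈ T') := by
    have h6' : (b :: r).IsChain (fun x y => s(x, y) ∈ T) := by
      rw [List.isChain_cons_cons] at h6; exact h6.2
    have hna : a ∉ b :: r := by rw [List.nodup_cons] at h3; exact h3.1
    rw [List.isChain_iff_getElem] at h6' ⊢
    intro i hi
    have := h6' i hi
    refine ⟨h2 _ this, (hTT _ this).resolve_left fun he => hna ?_⟩
    have ha : a ∈ s((b :: r)[i], (b :: r)[i + 1]) := by rw [he]; simp
    rcases Sym2.mem_iff.1 ha with h | h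
    · rw [h]; exact List.getElem_mem _
    · rw [h]; exact List.getElem_mem _
  have hne : ∀ {x y}, x ∈ S → y ∈ S → x ≠ u y := fun hx hy h => hu _ hy (h ▸ hx)
  have ct : ∀ x, List.count x (a :: b :: r) ≤ List.count x (a :: b :: r) := fun x => le_rfl
  have hmix := mix hSS huS hu hinj h3 h4 (a :: b :: r) [a, b] (a :: u a :: u b :: b :: r)
    ct (fun x => by simp only [List.count_cons, List.count_nil]; omega)
    (fun x => by simp only [List.count_cons, List.count_nil, List.map_cons, List.map_nil]; omega)
  refine ⟨T', a, u a, u b :: b :: r, ?_, ?_, hmix.2, hmix.1, ?_, ?_, ?_, ?_, ?_⟩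
  · have e1 : T'.card ≤ _ := card_union_le _ _
    have e2 := card_union_le {s(u a, u b)} W
    have e4 : W.card ≤ S.card := card_image_le
    have e5 := card_erase_of_mem habT
    have e6 : 0 < T.card := card_pos.2 ⟨_, habT⟩
    have e3 : S'.card = S.card + S.card := by
      rw [hS', card_union_of_disjoint, card_image_of_injOn hinj]
      rw [Finset.disjoint_right]
      intro x hx
      obtain ⟨z, hz, rfl⟩ := Finset.mem_image.1 hx
      exact hu z hz
    rw [card_singleton] at e2
    omega
  · intro e he
    rcases Finset.mem_union.1 he with he | he
    · exact h2 e (Finset.mem_of_mem_erase he)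
    rcases Finset.mem_union.1 he with he | he
    · rw [Finset.mem_singleton.1 he]; exact hhom a haS b hbS hab
    · obtain ⟨z, hz, rfl⟩ := Finset.mem_image.1 he
      exact hadj z hz
  · simp at h5 ⊢; omega
  · have : (b :: r).IsChain (fun x y => s(x, y) ∈ T') := hbr.imp fun x y h => h.2
    refine chain_head (chain_head (chain_head (x := b) (y := u b) this (by simp) ?_) (by simp) hfT) (by simp) (hvT a haS)
    rw [Sym2.eq_swap]; exact hvT b hbS
  · intro z hz; apply h7; simpa using hz
  · intro z hz
    rw [hS', Finset.mem_union] at hz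
    rcases hz with hz | hz
    · exact ⟨u z, huS z hz, hadj z hz⟩
    · obtain ⟨y, hy, rfl⟩ := Finset.mem_image.1 hz
      exact ⟨y, hSS y hy, (hadj y hy).symm⟩
  · intro X hseed hX
    obtain ⟨f1, f2, f3⟩ := seed_step hSS huS hu hinj hadj hhom hX hvT h3 h4 h5 hab hbr hfT h7 hseed
    set Y : Set (Sym2 V) := {e | e ∈ X ∧ e.map u ∈ X ∧ ∀ z ∈ e, s(z, u z) ∈ X} with hY
    have hYab : s(a, b) ∈ Y := by
      refine ⟨f1, by simpa using f2, ?_⟩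
      intro z hz
      rcases Sym2.mem_iff.1 hz with rfl | rfl
      · exact hseed
      · exact f3
    have hYall := h9 Y hYab ?_
    · intro x hx y hy hxy
      rcases hcl x hx y hy hxy with ⟨hx, hy⟩ | ⟨z, hz, e⟩ | ⟨z, hz, w, hw, hzw, e⟩
      · exact (hYall x hx y hy hxy).1
      · rw [e]
        obtain ⟨y, hy, hzy⟩ := h8 z hz
        exact (hYall z hz y hy hzy).2.2 z (by simp)
      · rw [e]
        simpa using (hYall z hz w hw hzw).2.1
    · intro s p q t x y hmS hn hl hc hpq hh hg hxy
      have hxm : x ∈ s ++ p :: q :: t := List.mem_of_head? hh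
      have hym : y ∈ s ++ p :: q :: t := List.mem_of_getLast? hg
      have hxS := hmS x hxm
      have hyS := hmS y hym
      have hpS := hmS p (by simp)
      have hqS := hmS q (by simp)
      set R : V → V → Prop := fun x y => F.Adj x y ∧ (s(x, y) ∈ X ∨ s(x, y) ∈ T') with hR
      have hRs : ∀ {x y}, R x y → R y x := by
        intro x y h
        simpa only [hR, F.adj_comm y x, Sym2.eq_swap (a := y) (b := x)] using h
      have hvR : ∀ x ∈ S, R x (u x) := fun x hx => ⟨hadj x hx, Or.inr (hvT x hx)⟩
      have hcR : (s ++ p :: q :: t).IsChain R := by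
        refine hc.imp fun x y h => ⟨h.1, ?_⟩
        rcases h.2 with h | h
        · exact Or.inl h.1
        · rcases hTT _ h with h | h
          · rw [h]; exact Or.inl f1
          · exact Or.inr h
      have hpqF : F.Adj p q := by
        rw [List.isChain_append, List.isChain_cons_cons] at hcR
        exact hcR.2.1.1.1
      have hpx : ∀ z w : V, z ∈ s ++ p :: q :: t → w ∈ s ++ p :: q :: t → z ≠ w →
          ∀ v, List.count v [z, w] ≤ List.count v (s ++ p :: q :: t) := by
        intro z w hz hw hzw v
        by_cases h1 : v = z
        · subst h1
          have := List.count_pos_iff.2 hz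
          have e : List.count v [v, w] = 1 := by simp [hzw.symm]
          omega
        · by_cases h2 : v = w
          · subst h2
            have := List.count_pos_iff.2 hw
            have e : List.count v [z, v] = 1 := by simp [hzw]
            omega
          · simp [Ne.symm h1, Ne.symm h2]
      have hxy0 : s(x, y) ∈ X := by
        have hm := mix hSS huS hu hinj hn hmS (s ++ p :: q :: t) [p, q]
          ((s ++ [p]) ++ u p :: u q :: (q :: t)) (fun _ => le_rfl)
          (hpx p q (by simp) (by simp) hpqF.ne)
          (fun x => by simp only [List.count_append, List.count_cons, List.count_nil, List.map_cons, List.map_nil]; omega)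
        refine hX (s ++ [p]) (u p) (u q) (q :: t) x y hm.1 hm.2 ?_ ?_ ?_ ?_ ?_ hxy
        · simp at hl ⊢; omega
        · rw [List.isChain_split, List.isChain_cons_cons] at hcR
          refine chain_join hcR.1 (x := p) (y := u p) ?_ (by simp) (by simp) (hvR p hpS)
          refine chain_head (x := u q) (chain_head hcR.2.2 (by simp) (hRs (hvR q hqS))) (by simp) ?_
          exact ⟨hhom p hpS q hqS hpqF, Or.inl (by simpa using hpq.2.1)⟩
        · simpa using hpq.2.1
        · rw [← hh]; cases s <;> simp
        · rw [← hg]; simp [List.getLast?_append, List.getLast?_cons]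
      have hct : ∀ v, List.count v [x, y] ≤ List.count v (s ++ p :: q :: t) := hpx x y hxm hym hxy.ne
      have hm1 := mix hSS huS hu hinj hn hmS (s ++ p :: q :: t) [x, y]
          ((u x :: s) ++ p :: q :: (t ++ [u y])) (fun _ => le_rfl) hct
          (fun x => by simp only [List.count_append, List.count_cons, List.count_nil, List.map_cons, List.map_nil]; omega)
      have hm2 := mix hSS huS hu hinj hn hmS (s ++ p :: q :: t) [x, y]
          (s ++ p :: q :: (t ++ [u y, u x])) (fun _ => le_rfl) hct
          (fun x => by simp only [List.count_append, List.count_cons, List.count_nil, List.map_cons, List.map_nil]; omega)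
      have hm3 := mix hSS huS hu hinj hn hmS (s ++ p :: q :: t) [x, y]
          ((u y :: u x :: s) ++ p :: q :: t) (fun _ => le_rfl) hct
          (fun x => by simp only [List.count_append, List.count_cons, List.count_nil, List.map_cons, List.map_nil]; omega)
      have hxyu := hhom x hxS y hyS hxy
      have c1 := chain_head hcR hh (hRs (hvR x hxS))
      have c2 := chain_last hcR hg (hvR y hyS)
      have hxy1 : s(u x, u y) ∈ X := by
        refine hX (u x :: s) p q (t ++ [u y]) (u x) (u y) hm1.1 hm1.2 ?_ ?_ hpq.1 (by simp) ?_ hxyu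
        · simp at hl ⊢; omega
        · have := chain_last c1 (x := y) (by rw [List.getLast?_cons, hg]; rfl) (hvR y hyS)
          simpa using this
        · simp [List.getLast?_append, List.getLast?_cons]
      have hRu : R (u x) (u y) := ⟨hxyu, Or.inl hxy1⟩
      refine ⟨hxy0, by simpa using hxy1, ?_⟩
      intro z hz
      rcases Sym2.mem_iff.1 hz with rfl | rfl
      · refine hX s p q (t ++ [u y, u z]) z (u z) hm2.1 hm2.2 ?_ ?_ hpq.1 ?_ ?_ (hadj z hxS)
        · simp at hl ⊢; omega
        · have := chain_last c2 (x := u y) (y := u z) (by simp [List.getLast?_append, List.getLast?_cons]) (hRs hRu)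
          simpa using this
        · rw [← hh]; cases s <;> simp
        · simp [List.getLast?_append, List.getLast?_cons]
      · rw [Sym2.eq_swap]
        refine hX (u z :: u x :: s) p q t (u z) z hm3.1 hm3.2 ?_ ?_ hpq.1 (by simp) ?_ (hadj z hyS).symm
        · simp at hl ⊢; omega
        · exact chain_head c1 (by simp) (hRs hRu)
        · rw [← hg]; simp [List.getLast?_append, List.getLast?_cons]

theorem grid_adj {k d : ℕ} {x y : Fin d → Fin k} : (grid k d).Adj x y ↔
    ∃ i, ((x i : ℕ) + 1 = y i ∨ (y i : ℕ) + 1 = x i) ∧ ∀ j, j ≠ i → x j = y j := by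
  unfold grid
  rw [SimpleGraph.fromRel_adj]
  constructor
  · rintro ⟨_, ⟨i, h, h'⟩ | ⟨i, h, h'⟩⟩
    · exact ⟨i, Or.inl h, h'⟩
    · exact ⟨i, Or.inr h, fun j hj => (h' j hj).symm⟩
  · rintro ⟨i, h, h'⟩
    refine ⟨?_, ?_⟩
    · rintro rfl; omega
    · rcases h with h | h
      · exact Or.inl ⟨i, h, h'⟩
      · exact Or.inr ⟨i, h, fun j hj => (h' j hj).symm⟩

/-- The box with upper corner `b`. -/
def Box (k : ℕ) {d : ℕ} (b : Fin d → ℕ) : Finset (Fin d → Fin k) :=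
  Finset.univ.filter fun x => ∀ i, (x i : ℕ) ≤ b i

theorem mem_Box {k d : ℕ} {b : Fin d → ℕ} {x : Fin d → Fin k} :
    x ∈ Box k b ↔ ∀ i, (x i : ℕ) ≤ b i := by simp [Box]

/-- Last layer in direction `j`. -/
def TopL (k : ℕ) {d : ℕ} (b : Fin d → ℕ) (j : Fin d) : Finset (Fin d → Fin k) :=
  (Box k b).filter fun x => (x j : ℕ) = b j

theorem mem_TopL {k d : ℕ} {b : Fin d → ℕ} {j : Fin d} {x : Fin d → Fin k} :
    x ∈ TopL k b j ↔ (∀ i, (x i : ℕ) ≤ b i) ∧ (x j : ℕ) = b j := by simp [TopL, mem_Box]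

theorem grid_step {k d : ℕ} (b : Fin d → ℕ) (j : Fin d) (hb : b j + 1 < k) :
    let S := Box k b
    let L := TopL k b j
    let u : (Fin d → Fin k) → (Fin d → Fin k) := fun x => Function.update x j ⟨b j + 1, hb⟩
    let S' := Box k (Function.update b j (b j + 1))
    S' = S ∪ L.image u ∧ (∀ x ∈ L, u x ∉ S) ∧ Set.InjOn u L ∧
    (∀ x ∈ L, (grid k d).Adj x (u x)) ∧
    (∀ x ∈ L, ∀ y ∈ L, (grid k d).Adj x y → (grid k d).Adj (u x) (u y)) ∧
    (∀ x ∈ S', ∀ y ∈ S', (grid k d).Adj x y →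
      (x ∈ S ∧ y ∈ S) ∨ (∃ z ∈ L, s(x, y) = s(z, u z)) ∨
      ∃ z ∈ L, ∃ w ∈ L, (grid k d).Adj z w ∧ s(x, y) = s(u z, u w)) := by
  intro S L u S'
  have huj : ∀ x, ((u x j : Fin k) : ℕ) = b j + 1 := fun x => by simp [u]
  have hui : ∀ x i, i ≠ j → u x i = x i := fun x i hi => by simp [u, hi]
  set lo : (Fin d → Fin k) → (Fin d → Fin k) :=
    fun x => Function.update x j ⟨b j, by omega⟩ with hlo
  have hloj : ∀ x, ((lo x j : Fin k) : ℕ) = b j := fun x => by simp [lo]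
  have hloi : ∀ x i, i ≠ j → lo x i = x i := fun x i hi => by simp [lo, hi]
  have hS'1 : ∀ x, x ∈ S' ↔ ((x j : ℕ) ≤ b j + 1 ∧ ∀ i, i ≠ j → (x i : ℕ) ≤ b i) := by
    intro x
    rw [mem_Box]
    constructor
    · intro h
      refine ⟨by simpa using h j, fun i hi => by simpa [hi] using h i⟩
    · rintro ⟨h1, h2⟩ i
      by_cases hi : i = j
      · subst hi; simpa using h1
      · simpa [hi] using h2 i hi
  have hS1 : ∀ x, x ∈ S' → (x j : ℕ) ≤ b j → x ∈ S := by
    intro x hx hj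
    rw [mem_Box]
    intro i
    by_cases hi : i = j
    · subst hi; exact hj
    · exact ((hS'1 x).1 hx).2 i hi
  have hL1 : ∀ x, x ∈ S' → lo x ∈ L := by
    intro x hx
    rw [mem_TopL]
    refine ⟨fun i => ?_, hloj x⟩
    by_cases hi : i = j
    · subst hi; exact (hloj x).le
    · rw [hloi x i hi]; exact ((hS'1 x).1 hx).2 i hi
  have hulo : ∀ x : Fin d → Fin k, (x j : ℕ) = b j + 1 → u (lo x) = x := by
    intro x hx
    funext i
    by_cases hi : i = j
    · subst hi; apply Fin.ext; rw [huj, hx]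
    · rw [hui _ _ hi, hloi _ _ hi]
  have hadj : ∀ x ∈ L, (grid k d).Adj x (u x) := by
    intro x hx
    rw [mem_TopL] at hx
    exact grid_adj.2 ⟨j, Or.inl (by rw [huj, hx.2]), fun i hi => (hui x i hi).symm⟩
  have key : ∀ x ∈ S', ∀ y ∈ S', (x j : ℕ) ≤ b j → (y j : ℕ) = b j + 1 → (grid k d).Adj x y →
      x ∈ L ∧ y = u x := by
    intro x hx y hy h1 h2 h
    obtain ⟨i, h, h'⟩ := grid_adj.1 h
    have hij : i = j := by
      by_contra hne
      have := h' j (Ne.symm hne)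
      rw [this] at h1; omega
    subst hij
    refine ⟨mem_TopL.2 ⟨mem_Box.1 (hS1 x hx h1), by omega⟩, ?_⟩
    funext i'
    by_cases hi : i' = i
    · subst hi; apply Fin.ext; rw [huj, h2]
    · rw [hui _ _ hi, h' _ hi]
  refine ⟨?_, ?_, ?_, hadj, ?_, ?_⟩
  · ext x
    rw [Finset.mem_union, Finset.mem_image]
    constructor
    · intro hx
      by_cases hj : (x j : ℕ) ≤ b j
      · exact Or.inl (hS1 x hx hj)
      · exact Or.inr ⟨lo x, hL1 x hx, hulo x (by have := ((hS'1 x).1 hx).1; omega)⟩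
    · rintro (hx | ⟨z, hz, rfl⟩)
      · rw [mem_Box] at hx
        exact (hS'1 x).2 ⟨(hx j).trans (by omega), fun i _ => hx i⟩
      · rw [mem_TopL] at hz
        refine (hS'1 _).2 ⟨(huj z).le, fun i hi => ?_⟩
        rw [hui z i hi]; exact hz.1 i
  · intro x _ hx
    have := mem_Box.1 hx j
    rw [huj] at this; omega
  · intro x hx y hy hxy
    have hx := (mem_TopL.1 hx).2
    have hy := (mem_TopL.1 hy).2
    funext i
    by_cases hi : i = j
    · subst hi; apply Fin.ext; rw [hx, hy]
    · rw [← hui x i hi, ← hui y i hi]; exact congrFun hxy i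
  · intro x hx y hy h
    have hx := (mem_TopL.1 hx).2
    have hy := (mem_TopL.1 hy).2
    obtain ⟨i, h, h'⟩ := grid_adj.1 h
    have hij : i ≠ j := by rintro rfl; omega
    refine grid_adj.2 ⟨i, ?_, ?_⟩
    · rw [hui _ _ hij, hui _ _ hij]; exact h
    · intro i' hi'
      by_cases hj : i' = j
      · subst hj; apply Fin.ext; rw [huj, huj]
      · rw [hui _ _ hj, hui _ _ hj, h' _ hi']
  · intro x hx y hy h
    by_cases h1 : (x j : ℕ) ≤ b j <;> by_cases h2 : (y j : ℕ) ≤ b j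
    · exact Or.inl ⟨hS1 x hx h1, hS1 y hy h2⟩
    · have := ((hS'1 y).1 hy).1
      obtain ⟨e1, e2⟩ := key x hx y hy h1 (by omega) h
      exact Or.inr (Or.inl ⟨x, e1, by rw [e2]⟩)
    · have := ((hS'1 x).1 hx).1
      obtain ⟨e1, e2⟩ := key y hy x hx h2 (by omega) h.symm
      exact Or.inr (Or.inl ⟨y, e1, by rw [e2, Sym2.eq_swap]⟩)
    · have hxj := ((hS'1 x).1 hx).1
      have hyj := ((hS'1 y).1 hy).1
      refine Or.inr (Or.inr ⟨lo x, hL1 x hx, lo y, hL1 y hy, ?_, ?_⟩)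
      · obtain ⟨i, h, h'⟩ := grid_adj.1 h
        have hij : i ≠ j := by rintro rfl; omega
        refine grid_adj.2 ⟨i, ?_, ?_⟩
        · rw [hloi _ _ hij, hloi _ _ hij]; exact h
        · intro i' hi'
          by_cases hj : i' = j
          · subst hj; apply Fin.ext; rw [hloj, hloj]
          · rw [hloi _ _ hj, hloi _ _ hj, h' _ hi']
      · rw [hulo x (by omega), hulo y (by omega)]

theorem gpath {k d : ℕ} (hk : 2 ≤ k) (b : Fin d → ℕ) (is : List (Fin d)) (hnd : is.Nodup)
    (hb : ∀ j ∈ is, 1 ≤ b j) : ∀ x ∈ Box k b, ∀ y ∈ Box k b, (grid k d).Adj x y →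
    (∀ j ∈ is, x j = y j) →
    ∃ p : List (Fin d → Fin k), p.Nodup ∧ p.length = 2 * is.length + 2 ∧
      p.IsChain (grid k d).Adj ∧ p.head? = some x ∧ p.getLast? = some y ∧ (∀ z ∈ p, z ∈ Box k b) ∧
      ∀ z ∈ p, ∀ j, j ∉ is → x j = y j → z j = x j := by
  induction is with
  | nil =>
    intro x hx y hy h _
    refine ⟨[x, y], ?_, by simp, by simpa using h, by simp, by simp, ?_, ?_⟩
    · simpa using h.ne
    · intro z hz; simp at hz; rcases hz with rfl | rfl <;> assumption
    · intro z hz j _ hj; simp at hz; rcases hz with rfl | rfl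
      · rfl
      · exact hj.symm
  | cons j is ih =>
    intro x hx y hy h hxy
    rw [List.nodup_cons] at hnd
    have hxj : x j = y j := hxy j (by simp)
    have hbj := hb j (by simp)
    obtain ⟨c, hc, hcb⟩ : ∃ c : Fin k, ((x j : ℕ) + 1 = c ∨ (c : ℕ) + 1 = x j) ∧ (c : ℕ) ≤ b j := by
      by_cases h0 : (x j : ℕ) = 0
      · exact ⟨⟨1, by omega⟩, Or.inl (by simp [h0]), hbj⟩
      · have := mem_Box.1 hx j
        exact ⟨⟨(x j : ℕ) - 1, by omega⟩, Or.inr (by simp; omega), by simp; omega⟩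
    have hcx : c ≠ x j := by rintro rfl; omega
    set x' := Function.update x j c with hx'
    set y' := Function.update y j c with hy'
    have hfS : ∀ w ∈ Box k b, Function.update w j c ∈ Box k b := by
      intro w hw
      rw [mem_Box] at hw ⊢
      intro i
      by_cases hi : i = j
      · subst hi; simpa using hcb
      · simpa [hi] using hw i
    have hfa : ∀ w : Fin d → Fin k, w j = x j → (grid k d).Adj w (Function.update w j c) := by
      intro w hw
      exact grid_adj.2 ⟨j, by simpa [hw] using hc, fun i hi => by simp [hi]⟩
    have hadj' : (grid k d).Adj x' y' := by
      obtain ⟨i, h, h'⟩ := grid_adj.1 h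
      have hij : i ≠ j := by rintro rfl; rw [hxj] at h; omega
      refine grid_adj.2 ⟨i, by simpa [x', y', hij] using h, fun i' hi' => ?_⟩
      by_cases hj : i' = j
      · subst hj; simp [x', y']
      · simp [x', y', hj, h' _ hi']
    obtain ⟨p, p1, p2, p3, p4, p5, p6, p7⟩ := ih hnd.2 (fun i hi => hb i (by simp [hi])) x' (hfS x hx) y' (hfS y hy)
      hadj' (by
        intro i hi
        have hij : i ≠ j := by rintro rfl; exact hnd.1 hi
        simpa [x', y', hij] using hxy i (by simp [hi]))
    have hpj : ∀ z ∈ p, z j = c := by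
      intro z hz
      rw [p7 z hz j hnd.1 (by simp [x', y'])]; simp [x']
    have hxp : x ∉ p := fun h => hcx (hpj x h).symm
    have hyp : y ∉ p := fun h => hcx (by rw [hxj]; exact (hpj y h).symm)
    refine ⟨x :: (p ++ [y]), ?_, ?_, ?_, by simp, ?_, ?_, ?_⟩
    · simp [List.nodup_append, p1, hxp, h.ne]
      rintro a ha rfl; exact hyp ha
    · simp [p2]; ring
    · refine chain_head (x := x') (chain_last (x := y') p3 p5 (hfa y hxj.symm).symm) ?_ (hfa x rfl)
      rw [List.head?_append, p4]; rfl
    · simp [List.getLast?_cons]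
    · intro z hz
      simp at hz
      rcases hz with rfl | hz | rfl
      · exact hx
      · exact p6 z hz
      · exact hy
    · intro z hz i hi hxyi
      simp at hz hi
      rcases hz with rfl | hz | rfl
      · rfl
      · rw [p7 z hz i hi.2 (by simp [x', y', hi.1, hxyi])]; simp [x', hi.1]
      · exact hxyi.symm

/-- Corner of the `n`-dimensional cube. -/
def cubeB (d n : ℕ) : Fin d → ℕ := fun i => if i.val < n then 1 else 0

theorem PP_cube {k d : ℕ} (hk : 2 ≤ k) (n : ℕ) (hn : n + 1 ≤ d) :
    PP (grid k d) (Box k (cubeB d (n + 1))) (2 * (n + 1)) := by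
  induction n with
  | zero =>
    set a : Fin d → Fin k := fun _ => ⟨0, by omega⟩ with ha
    set i0 : Fin d := ⟨0, by omega⟩ with hi0
    set e : Fin d → Fin k := Function.update a i0 ⟨1, by omega⟩ with he
    have hae : (grid k d).Adj a e := grid_adj.2 ⟨i0, by simp [a, e], fun j hj => by simp [e, hj]⟩
    have haS : a ∈ Box k (cubeB d (0 + 1)) := mem_Box.2 fun i => by simp [a]
    have hiz : ∀ i : Fin d, i ≠ i0 → i.val ≠ 0 := fun i hi h => hi (Fin.ext h)
    have heS : e ∈ Box k (cubeB d (0 + 1)) := mem_Box.2 fun i => by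
      by_cases hi : i = i0
      · subst hi; simp [e, cubeB, i0]
      · simp [e, hi, a]
    have hall : ∀ x ∈ Box k (cubeB d (0 + 1)), x = a ∨ x = e := by
      intro x hx
      rw [mem_Box] at hx
      have h0 : ∀ i, i ≠ i0 → (x i : ℕ) = 0 := by
        intro i hi
        have := hx i
        simp [cubeB, hiz i hi] at this
        omega
      have h1 : (x i0 : ℕ) ≤ 1 := by simpa [cubeB, i0] using hx i0
      by_cases h : (x i0 : ℕ) = 0
      · left; funext i; apply Fin.ext
        by_cases hi : i = i0
        · subst hi; simpa [a] using h
        · simpa [a] using h0 i hi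
      · right; funext i; apply Fin.ext
        by_cases hi : i = i0
        · subst hi; simp [e]; omega
        · simpa [e, a, hi] using h0 i hi
    refine ⟨{s(a, e)}, a, e, [], ?_, ?_, by simpa using hae.ne, ?_, by simp, by simp, ?_, ?_, ?_⟩
    · have : ({a, e} : Finset _) ⊆ Box k (cubeB d (0 + 1)) := by
        intro z hz; simp at hz; rcases hz with rfl | rfl <;> assumption
      have := card_le_card this
      rw [card_pair hae.ne] at this
      simpa using this
    · intro f hf; rw [Finset.mem_singleton.1 hf]; exact hae
    · intro z hz; simp at hz; rcases hz with rfl | rfl <;> assumption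
    · intro z hz; simp at hz; subst hz; exact hae.symm
    · intro z hz
      rcases hall z hz with rfl | rfl
      · exact ⟨e, heS, hae⟩
      · exact ⟨a, haS, hae.symm⟩
    · intro X hX _ x hx y hy hxy
      rcases hall x hx with rfl | rfl <;> rcases hall y hy with rfl | rfl
      · exact absurd rfl hxy.ne
      · exact hX
      · rw [Sym2.eq_swap]; exact hX
      · exact absurd rfl hxy.ne
  | succ n ih =>
    have ih := ih (by omega)
    set j : Fin d := ⟨n + 1, by omega⟩ with hj
    have hbj : cubeB d (n + 1) j = 0 := by simp [cubeB, j]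
    have hg := grid_step (k := k) (cubeB d (n + 1)) j (by omega)
    have hL : TopL k (cubeB d (n + 1)) j = Box k (cubeB d (n + 1)) := by
      ext x
      rw [mem_TopL, mem_Box]
      refine ⟨fun h => h.1, fun h => ⟨h, ?_⟩⟩
      have := h j
      omega
    have hb' : Function.update (cubeB d (n + 1)) j (cubeB d (n + 1) j + 1) = cubeB d (n + 1 + 1) := by
      funext i
      by_cases hi : i = j
      · subst hi; simp [cubeB, j]
      · have : i.val ≠ n + 1 := fun h => hi (Fin.ext h)
        rw [Function.update_of_ne hi]
        simp only [cubeB]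
        split_ifs <;> omega
    simp only [hL, hb'] at hg
    obtain ⟨g1, g2, g3, g4, g5, g6⟩ := hg
    exact PP_step ih g1 g2 g3 g4 g5 g6

theorem QQ_box {k d l : ℕ} (hk : 2 ≤ k) (hl : 2 ≤ l) (hd : l ≤ d) (N : ℕ) :
    ∀ b : Fin d → ℕ, (∀ i, b i < k) → (∀ i, cubeB d l i ≤ b i) → ∑ i, b i = N →
    QQ (grid k d) (Box k b) (2 * l) := by
  induction N with
  | zero =>
    intro b _ hb hN
    have h0 : b ⟨0, by omega⟩ = 0 := by
      have := Finset.sum_eq_zero_iff.1 hN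
      exact this _ (Finset.mem_univ _)
    have := hb ⟨0, by omega⟩
    have h2 : 0 < l := by omega
    simp [cubeB, h0, h2] at this
  | succ N ih =>
    intro b hbk hb hN
    by_cases heq : b = cubeB d l
    · subst heq
      obtain ⟨n, rfl⟩ : ∃ n, l = n + 1 := ⟨l - 1, by omega⟩
      exact QQ_of_PP (PP_cube hk n hd)
    · obtain ⟨j, hj⟩ : ∃ j, b j ≠ cubeB d l j := by
        by_contra h; push Not at h; exact heq (funext h)
      have hjl : cubeB d l j < b j := lt_of_le_of_ne (hb j) (Ne.symm hj)
      set b' := Function.update b j (b j - 1) with hb'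
      have hb'j : b' j = b j - 1 := by simp [b']
      have hbb : Function.update b' j (b' j + 1) = b := by
        funext i
        by_cases hi : i = j
        · subst hi; simp [b']; omega
        · simp [b', hi]
      have hbc : ∀ i, cubeB d l i ≤ b' i := by
        intro i
        by_cases hi : i = j
        · subst hi; rw [hb'j]; omega
        · simpa [b', hi] using hb i
      have hQ := ih b' (fun i => by
          by_cases hi : i = j
          · subst hi; have := hbk i; omega
          · simpa [b', hi] using hbk i) hbc (by
          have h1 := Finset.sum_update_of_mem (Finset.mem_univ j) b (b j - 1)
          have h2 := Finset.add_sum_erase Finset.univ b (Finset.mem_univ j)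
          rw [Finset.sdiff_singleton_eq_erase] at h1
          rw [← hb'] at h1
          omega)
      have hg := grid_step (k := k) b' j (by have := hbk j; omega)
      simp only [hbb] at hg
      obtain ⟨g1, g2, g3, g4, g5, g6⟩ := hg
      obtain ⟨m, rfl⟩ : ∃ m, l = m + 2 := ⟨l - 2, by omega⟩
      refine QQ_step (m := 2 * m + 2) hQ g1 g2 g3 g4 g6 ?_
      intro x hx y hy hxy
      have hx' := mem_Box.2 (mem_TopL.1 hx).1
      have hy' := mem_Box.2 (mem_TopL.1 hy).1
      obtain ⟨i, h, h'⟩ := grid_adj.1 hxy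
      set A : Finset (Fin d) := (Finset.univ.filter fun t : Fin d => t.val < m + 2).erase i with hA
      have hAc : m ≤ A.card := by
        have e1 : (Finset.univ.filter fun t : Fin d => t.val < m + 2).card - 1 ≤ A.card :=
          Finset.pred_card_le_card_erase
        have e2 : (Finset.univ.filter fun t : Fin d => t.val < m + 2).card = m + 2 := by
          rw [Fin.card_filter_val_lt]; omega
        omega
      obtain ⟨B, hBA, hBc⟩ := Finset.exists_subset_card_eq hAc
      obtain ⟨p, p1, p2, p3, p4, p5, p6, -⟩ := gpath hk b' B.toList (Finset.nodup_toList _) (by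
        intro t ht
        have := hBA (Finset.mem_toList.1 ht)
        simp [A] at this
        have h2 := hbc t
        simpa [cubeB, this.2] using h2) x hx' y hy' hxy (by
        intro t ht
        have := hBA (Finset.mem_toList.1 ht)
        simp [A] at this
        exact h' t this.1)
      exact ⟨p, p1, by rw [p2, Finset.length_toList, hBc], p3, p4, p5, p6⟩

open scoped Fin.CommRing in
theorem fin_step {m : ℕ} {i j : Fin (m + 4)} (h : i - j = 1) :
    i.val = j.val + 1 ∨ (i.val = 0 ∧ j.val = m + 3) := by
  have h1 : i = j + 1 := by rw [← h]; ring
  have h2 : i.val = (j.val + 1) % (m + 4) := by rw [h1, Fin.val_add]; simp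
  by_cases hj : j.val + 1 < m + 4
  · rw [Nat.mod_eq_of_lt hj] at h2; exact Or.inl h2
  · have : j.val + 1 = m + 4 := by omega
    rw [this, Nat.mod_self] at h2
    exact Or.inr ⟨h2, by omega⟩

theorem copy_of_path {W : Type*} {G : SimpleGraph W} {m : ℕ} (p : List W) (x y : W)
    (hnd : p.Nodup) (hlen : p.length = m + 4) (hch : p.IsChain G.Adj)
    (hx : p.head? = some x) (hy : p.getLast? = some y) (hxy : G.Adj x y) :
    CopyAt (cycleGraph (m + 4)) G x y := by
  have hx0 : p[0] = x := by
    rw [List.head?_eq_getElem?, List.getElem?_eq_getElem (by omega)] at hx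
    simpa using hx
  have hyl : p[m + 3] = y := by
    rw [List.getLast?_eq_getElem?, List.getElem?_eq_getElem (by omega)] at hy
    simpa [hlen] using hy
  rw [List.isChain_iff_getElem] at hch
  have key : ∀ i j : Fin (m + 4), i - j = 1 → G.Adj (p[j.val]) (p[i.val]) := by
    intro i j h
    rcases fin_step h with h | ⟨h1, h2⟩
    · have := hch j.val (by omega)
      simpa only [h] using this
    · simp only [h1, h2, hx0, hyl]; exact hxy.symm
  refine ⟨fun i => p[i.val], ?_, ?_, 0, Fin.last (m + 3), ?_, ?_, ?_⟩
  · intro i j h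
    exact Fin.ext ((hnd.getElem_inj_iff).1 h)
  · intro a b h
    rcases (cycleGraph_adj (n := m + 2)).1 h with h | h
    · exact (key _ _ h).symm
    · exact key _ _ h
  · refine (cycleGraph_adj (n := m + 2)).2 (Or.inl ?_)
    refine sub_eq_iff_eq_add.2 ?_
    exact ((add_comm _ _).trans (Fin.last_add_one (m + 3))).symm
  · simpa using hx0
  · simpa using hyl

theorem ws_of_closed {W : Type*} [Finite W] {F : SimpleGraph W} {m : ℕ} (N : ℕ) :
    ∀ G : SimpleGraph W, G ≤ F → (F.edgeSet \ G.edgeSet).ncard = N →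
    (∀ X : Set (Sym2 W), CRule F (m + 4) X → G.edgeSet ⊆ X → F.edgeSet ⊆ X) →
    WeaklySaturated F G (cycleGraph (m + 4)) := by
  induction N using Nat.strong_induction_on with
  | _ N ih =>
  intro G hG hN hcl
  by_cases hGF : G = F
  · exact ⟨hG, 0, fun _ => G, rfl, hGF, by simp⟩
  have hnc : ¬ CRule F (m + 4) G.edgeSet := by
    intro h
    exact hGF (le_antisymm hG (edgeSet_subset_edgeSet.1 (hcl _ h subset_rfl)))
  unfold CRule at hnc
  push Not at hnc
  obtain ⟨p, x, y, p1, p2, p3, p4, p5, hxy, hne⟩ := hnc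
  set G' := G ⊔ SimpleGraph.fromEdgeSet {s(x, y)} with hG'
  have hxy' : G'.Adj x y := by
    rw [hG', sup_adj, fromEdgeSet_adj]; exact Or.inr ⟨rfl, hxy.ne⟩
  have hGG' : G ≤ G' := le_sup_left
  have hG'F : G' ≤ F := by
    refine sup_le hG ?_
    intro a b h
    rw [fromEdgeSet_adj] at h
    have h1 : s(a, b) = s(x, y) := h.1
    rw [← mem_edgeSet, h1]; exact hxy
  have hlt : (F.edgeSet \ G'.edgeSet).ncard < N := by
    rw [← hN]
    refine Set.ncard_lt_ncard ⟨?_, ?_⟩ (Set.toFinite _)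
    · exact Set.sdiff_subset_sdiff_right (edgeSet_subset_edgeSet.2 hGG')
    · intro h
      exact (h (show s(x, y) ∈ F.edgeSet \ G.edgeSet from ⟨hxy, hne⟩)).2 hxy'
  obtain ⟨-, n, seq, s0, sn, hs⟩ := ih _ hlt G' hG'F rfl
    (fun X hX h => hcl X hX ((edgeSet_subset_edgeSet.2 hGG').trans h))
  refine ⟨hG, n + 1, fun i => if i = 0 then G else seq (i - 1), by simp, by simpa using sn, ?_⟩
  intro i hi
  rcases i with _ | i
  · refine ⟨x, y, by simpa using hne, hxy, by simpa using s0, ?_⟩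
    have hc : CopyAt (cycleGraph (m + 4)) G' x y :=
      copy_of_path p x y p1 p2 (p3.imp fun a b h => hGG' h.2) p4 p5 hxy'
    simpa [s0] using hc
  · simpa using hs i (by omega)

open scoped Fin.CommRing in
theorem reach_of_copy {W : Type*} {G : SimpleGraph W} {m : ℕ} {u v : W}
    (h : CopyAt (cycleGraph (m + 4)) (G ⊔ SimpleGraph.fromEdgeSet {s(u, v)}) u v) :
    G.Reachable u v := by
  obtain ⟨f, hf, hadj, a, b, hab, rfl, rfl⟩ := h
  have key : ∀ a b : Fin (m + 4), b - a = 1 →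
      (∀ ⦃i j⦄, (cycleGraph (m + 4)).Adj i j →
        G.Adj (f i) (f j) ∨ s(f i, f j) = s(f a, f b)) → G.Reachable (f b) (f a) := by
    intro a b hba hadj
    have hb : b = a + 1 := by rw [← hba]; ring
    have hr : ∀ t : ℕ, t ≤ m + 3 → G.Reachable (f b) (f (b + (t : Fin (m + 4)))) := by
      intro t
      induction t with
      | zero => intro _; simp
      | succ t ih =>
        intro ht
        refine (ih (by omega)).trans ?_
        have h1 : (cycleGraph (m + 4)).Adj (b + (t : Fin (m + 4)))
            (b + ((t + 1 : ℕ) : Fin (m + 4))) :=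
          (cycleGraph_adj (n := m + 2)).2 (Or.inr (by push_cast; ring))
        rcases hadj h1 with h2 | h2
        · exact h2.reachable
        · exfalso
          rw [Sym2.eq_iff] at h2
          rcases h2 with ⟨-, h3⟩ | ⟨h3, h4⟩
          · have h3 := hf h3
            rw [add_eq_left, Fin.natCast_eq_zero] at h3
            have := Nat.le_of_dvd (by omega) h3
            omega
          · have h3 := hf h3
            have h4 := hf h4
            rw [add_eq_left] at h3
            have h5 : ((2 : ℕ) : Fin (m + 4)) = 0 := by
              have : a + (2 + (t : Fin (m + 4))) = a := by
                rw [hb] at h4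
                push_cast at h4
                linear_combination h4
              rw [add_eq_left, h3, add_zero] at this
              exact_mod_cast this
            rw [Fin.natCast_eq_zero] at h5
            have := Nat.le_of_dvd (by omega) h5
            omega
    have h6 := hr (m + 3) le_rfl
    have h7 : b + ((m + 3 : ℕ) : Fin (m + 4)) = a := by
      have : ((m + 4 : ℕ) : Fin (m + 4)) = 0 := Fin.natCast_self _
      push_cast at this ⊢
      rw [hb]
      linear_combination this
    rwa [h7] at h6
  have hadj' : ∀ ⦃i j⦄, (cycleGraph (m + 4)).Adj i j →
        G.Adj (f i) (f j) ∨ s(f i, f j) = s(f a, f b) := by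
    intro i j h
    have := hadj h
    rw [sup_adj, fromEdgeSet_adj] at this
    exact this.imp id fun h => h.1
  rcases (cycleGraph_adj (n := m + 2)).1 hab with h | h
  · exact key b a h (fun i j hij => by rw [Sym2.eq_swap (a := f b)]; exact hadj' hij)
  · exact (key a b h hadj').symm

theorem connected_of_ws {W : Type*} {F G : SimpleGraph W} {m : ℕ} (hF : F.Connected)
    (h : WeaklySaturated F G (cycleGraph (m + 4))) : G.Connected := by
  obtain ⟨-, n, seq, s0, sn, hs⟩ := h
  have hback : ∀ t, t ≤ n → (seq (n - t)).Connected := by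
    intro t
    induction t with
    | zero => intro _; simpa [sn] using hF
    | succ t ih =>
      intro ht
      have hc := ih (by omega)
      obtain ⟨u, v, -, -, h3, h4⟩ := hs (n - (t + 1)) (by omega)
      have e : n - (t + 1) + 1 = n - t := by omega
      rw [e] at h3 h4
      rw [h3] at h4 hc
      have hr := reach_of_copy h4
      have := hc.nonempty
      refine ⟨fun x y => ?_⟩
      obtain ⟨w⟩ := hc.preconnected x y
      induction w with
      | nil => exact Reachable.refl _
      | cons hadj _ ihw =>
        refine Reachable.trans ?_ ihw
        rw [sup_adj, fromEdgeSet_adj] at hadj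
        rcases hadj with hadj | ⟨hadj, -⟩
        · exact hadj.reachable
        · have hadj : s(_, _) = s(_, _) := hadj
          rw [Sym2.eq_iff] at hadj
          rcases hadj with ⟨rfl, rfl⟩ | ⟨rfl, rfl⟩
          · exact hr
          · exact hr.symm
  have := hback n le_rfl
  simpa [s0] using this

theorem grid_connected {k d : ℕ} (hk : 2 ≤ k) : (grid k d).Connected := by
  set z : Fin d → Fin k := fun _ => ⟨0, by omega⟩ with hz
  have key : ∀ (N : ℕ) (x : Fin d → Fin k), ∑ i, (x i : ℕ) = N → (grid k d).Reachable x z := by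
    intro N
    induction N with
    | zero =>
      intro x hx
      have : x = z := by
        funext i
        apply Fin.ext
        exact Finset.sum_eq_zero_iff.1 hx i (Finset.mem_univ _)
      rw [this]
    | succ N ih =>
      intro x hx
      obtain ⟨j, hj⟩ : ∃ j, (x j : ℕ) ≠ 0 := by
        by_contra h
        push Not at h
        simp [h] at hx
      set y : Fin d → Fin k := Function.update x j ⟨(x j : ℕ) - 1, by omega⟩ with hy
      have hyj : (y j : ℕ) = x j - 1 := by simp [y]
      have hyi : ∀ i, i ≠ j → y i = x i := fun i hi => by simp [y, hi]
      have hadj : (grid k d).Adj x y :=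
        grid_adj.2 ⟨j, Or.inr (by omega), fun i hi => (hyi i hi).symm⟩
      refine hadj.reachable.trans (ih y ?_)
      have h1 := Finset.add_sum_erase Finset.univ (fun i => (x i : ℕ)) (Finset.mem_univ j)
      have h2 := Finset.add_sum_erase Finset.univ (fun i => (y i : ℕ)) (Finset.mem_univ j)
      have h3 : ∑ i ∈ Finset.univ.erase j, (y i : ℕ) = ∑ i ∈ Finset.univ.erase j, (x i : ℕ) :=
        Finset.sum_congr rfl fun i hi => by rw [hyi i (Finset.ne_of_mem_erase hi)]
      omega
  have : Nonempty (Fin d → Fin k) := ⟨z⟩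
  exact ⟨fun x y => (key _ x rfl).trans (key _ y rfl).symm⟩

theorem stmt_8 (k d l : ℕ) (hk : 2 ≤ k) (hl : 2 ≤ l) (hd : l ≤ d) :
    wsatNum (grid k d) (cycleGraph (2 * l)) = k ^ d - 1 := by
  have hQ := QQ_box (k := k) (d := d) (l := l) hk hl hd _ (fun _ => k - 1) (fun _ => by omega)
    (fun i => by unfold cubeB; split_ifs <;> omega) rfl
  obtain ⟨m, hm⟩ : ∃ m, 2 * l = m + 4 := ⟨2 * l - 4, by omega⟩
  rw [hm] at hQ ⊢
  have hbox : Box k (fun _ : Fin d => k - 1) = Finset.univ := by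
    ext x
    simp only [mem_Box, Finset.mem_univ, iff_true]
    intro i
    have := (x i).2
    omega
  rw [hbox] at hQ
  obtain ⟨T, T1, T2, T3⟩ := hQ
  have hcard : (Finset.univ : Finset (Fin d → Fin k)).card = k ^ d := by simp
  rw [hcard] at T1
  have hlow : ∀ n ∈ {n | ∃ G, WeaklySaturated (grid k d) G (cycleGraph (m + 4)) ∧
      G.edgeSet.ncard = n}, k ^ d - 1 ≤ n := by
    rintro n ⟨G, hG, rfl⟩
    have := (connected_of_ws (grid_connected hk) hG).card_vert_le_card_edgeSet_add_one
    rw [Nat.card_eq_fintype_card, Fintype.card_fun, Fintype.card_fin, Fintype.card_fin] at this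
    rw [← Nat.card_coe_set_eq]
    omega
  set G0 : SimpleGraph (Fin d → Fin k) := SimpleGraph.fromEdgeSet (T : Set _) with hG0
  have hG0e : G0.edgeSet = T := by
    rw [hG0, edgeSet_fromEdgeSet]
    refine sdiff_eq_left.2 (Set.disjoint_left.2 fun e he hd => ?_)
    exact (grid k d).not_isDiag_of_mem_edgeSet (T2 e he) (by simpa using hd)
  have hws : WeaklySaturated (grid k d) G0 (cycleGraph (m + 4)) := by
    refine ws_of_closed _ G0 ?_ rfl ?_
    · rw [← edgeSet_subset_edgeSet, hG0e]; exact fun e he => T2 e he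
    · intro X hX h
      rw [hG0e] at h
      intro e
      induction e with
      | _ x y => exact fun he => T3 X (fun e he => h he) hX x (by simp) y (by simp) he
  have hmem : G0.edgeSet.ncard ∈ {n | ∃ G, WeaklySaturated (grid k d) G (cycleGraph (m + 4)) ∧
      G.edgeSet.ncard = n} := ⟨G0, hws, rfl⟩
  refine le_antisymm ((Nat.sInf_le hmem).trans ?_) (le_csInf ⟨_, hmem⟩ hlow)
  rw [hG0e, Set.ncard_coe_finset]
  omega
end

section
/- For every fixed m ≥ 2, sat(Q_d, Q_m) ≤ (1+o(1))·72·m^2·2^d as d → ∞; in particular sat(Q_d,Q_m) = O(2^d). -/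
open SimpleGraph Finset

namespace SatCube

/-- Vertices of the hypercube. -/
abbrev V (d : ℕ) := Fin d → ZMod 2

/-- The unit vector in direction `i`. -/
abbrev e {d : ℕ} (i : Fin d) : V d := Pi.single i 1

lemma z2_add_self : ∀ z : ZMod 2, z + z = 0 := by decide

lemma z2_cases : ∀ z : ZMod 2, z = 0 ∨ z = 1 := by decide

lemma z2_ne : ∀ a b : ZMod 2, a ≠ b → b = a + 1 := by decide

lemma z2_ne_succ : ∀ a : ZMod 2, a ≠ a + 1 := by decide

lemma v_add_self {d : ℕ} (x : V d) : x + x = 0 := by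
  funext j; exact z2_add_self _

lemma v_add_add {d : ℕ} (x y : V d) : x + y + y = x := by
  rw [add_assoc, v_add_self, add_zero]

lemma e_inj {d : ℕ} {i j : Fin d} (h : e i = e j) : i = j := by
  by_contra hij
  have := congrFun h i
  simp [e, Pi.single_apply, hij] at this

lemma e_ne_zero {d : ℕ} (i : Fin d) : e i ≠ 0 := by
  intro h
  have := congrFun h i
  simp [e] at this

lemma cube_adj {d : ℕ} (u v : V d) : (cube d).Adj u v ↔ ∃ i, v = u + e i := by
  unfold cube
  rw [SimpleGraph.fromRel_adj]
  have key : ∀ u v : V d, (∃ i, u i ≠ v i ∧ ∀ j, j ≠ i → u j = v j) → ∃ i, v = u + e i := by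
    rintro u v ⟨i, h1, h2⟩
    refine ⟨i, ?_⟩
    funext j
    by_cases hj : j = i
    · subst hj
      simpa [e] using z2_ne _ _ h1
    · simp [e, Pi.single_apply, hj, h2 j hj]
  constructor
  · rintro ⟨_, h | h⟩
    · exact key _ _ h
    · obtain ⟨i, hi⟩ := key _ _ h
      exact ⟨i, by rw [hi, v_add_add]⟩
  · rintro ⟨i, rfl⟩
    refine ⟨fun h => e_ne_zero i (by simpa using h.symm), Or.inl ⟨i, ?_, ?_⟩⟩
    · simp [e]
    · intro j hj
      simp [e, Pi.single_apply, hj]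

/-- Induction over the hypercube by flipping coordinates. -/
lemma cube_induction {m : ℕ} (P : V m → Prop) (h0 : P 0)
    (hs : ∀ a j, P a → P (a + e j)) (a : V m) : P a := by
  have key : ∀ s : Finset (Fin m), P (∑ j ∈ s, Pi.single j (a j)) := by
    intro s
    induction s using Finset.induction_on with
    | empty => simpa using h0
    | insert j s hj ih =>
      rw [Finset.sum_insert hj, add_comm]
      rcases z2_cases (a j) with h | h
      · rw [h]; simpa using ih
      · rw [h]; exact hs _ _ ih
  have := key Finset.univ
  rwa [Finset.univ_sum_single] at this

/-- Every copy of `Q_m` in `Q_d` is a subcube. -/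
lemma copy_structure {m d : ℕ} (f : V m → V d) (hf : Function.Injective f)
    (hadj : ∀ ⦃a b⦄, (cube m).Adj a b → (cube d).Adj (f a) (f b)) :
    ∃ δ : Fin m → Fin d, Function.Injective δ ∧ ∀ a j, f (a + e j) = f a + e (δ j) := by
  have h1 : ∀ a j, ∃ i, f (a + e j) = f a + e i := fun a j =>
    (cube_adj _ _).1 (hadj ((cube_adj _ _).2 ⟨j, rfl⟩))
  choose D hD using h1
  have hinj : ∀ a, Function.Injective (D a) := by
    intro a j j' h
    have : f (a + e j) = f (a + e j') := by rw [hD, hD, h]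
    exact e_inj (add_left_cancel (hf this))
  have hstep : ∀ a j k, D (a + e k) j = D a j := by
    intro a j k
    by_cases hjk : j = k
    · subst hjk
      have h2 := hD (a + e j) j
      rw [v_add_add, hD a j] at h2
      have h3 : e (D (a + e j) j) = e (D a j) := by
        have := congrArg (fun z => f a + z) h2
        simp only [← add_assoc, v_add_self, zero_add] at this
        have h4 := congrArg (fun z => e (D a j) + z) this
        simp only [← add_assoc, v_add_self, zero_add, add_zero] at h4
        exact h4.symm
      exact e_inj h3
    · have h2 : f (a + e k + e j) = f (a + e j + e k) := by
        rw [add_assoc, add_comm (e k), ← add_assoc]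
      rw [hD, hD, hD, hD, add_assoc, add_assoc] at h2
      have h3 := add_left_cancel h2
      have h4 := congrFun h3 (D a j)
      have hne1 : D a j ≠ D a k := fun h => hjk (hinj a h)
      have hne2 : D a j ≠ D (a + e j) k := by
        intro h
        have h5 : f (a + e j + e k) = f a := by
          rw [hD, hD, ← h, v_add_add]
        have h6 := hf h5
        rw [add_assoc] at h6
        have h7 : e j + e k = 0 := by simpa using h6
        apply hjk
        apply e_inj
        have := congrArg (fun z => z + e k) h7
        simpa [v_add_add] using this
      by_contra hne
      simp [e, Pi.single_apply, hne1, hne2, Ne.symm hne] at h4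
  have hconst : ∀ a j, D a j = D 0 j := by
    intro a j
    exact cube_induction (fun a => D a j = D 0 j) rfl (fun a k h => by rw [hstep, h]) a
  exact ⟨D 0, hinj 0, fun a j => by rw [hD, hconst]⟩

/-- Labels of the coordinates: side, type, block and Hamming label, with a section. -/
structure Dat (d n r : ℕ) where
  sd : Fin d → Bool
  ty : Fin d → ZMod 2
  bl : Fin d → Fin n
  lb : Fin d → V r
  sec : Bool → ZMod 2 → Fin n → V r → Fin d
  sd_sec : ∀ s t k v, sd (sec s t k v) = s
  ty_sec : ∀ s t k v, ty (sec s t k v) = t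
  bl_sec : ∀ s t k v, bl (sec s t k v) = k
  lb_sec : ∀ s t k v, lb (sec s t k v) = v

variable {d n r : ℕ} (D : Dat d n r)

/-- Syndrome of a block. -/
def syn (s : Bool) (t : ZMod 2) (k : Fin n) (x : V d) : V r :=
  ∑ i, if D.sd i = s ∧ D.ty i = t ∧ D.bl i = k then x i • D.lb i else 0

/-- Colour of the edge at `x` in direction `i`. -/
def col (x : V d) (i : Fin d) : ZMod 2 :=
  ∑ j, if D.sd j = D.sd i ∧ j ≠ i then x j else 0

lemma syn_flip (s : Bool) (t : ZMod 2) (k : Fin n) (x : V d) (i : Fin d) :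
    syn D s t k (x + e i) = syn D s t k x +
      if D.sd i = s ∧ D.ty i = t ∧ D.bl i = k then D.lb i else 0 := by
  have h : (if D.sd i = s ∧ D.ty i = t ∧ D.bl i = k then D.lb i else 0) =
      ∑ j, if j = i then
        (if D.sd j = s ∧ D.ty j = t ∧ D.bl j = k then D.lb j else 0) else 0 := by
    rw [Finset.sum_ite_eq']; simp
  rw [h, syn, syn, ← Finset.sum_add_distrib]
  refine Finset.sum_congr rfl fun j _ => ?_
  by_cases hj : j = i
  · subst hj
    by_cases hc : D.sd j = s ∧ D.ty j = t ∧ D.bl j = k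
    · simp [hc, e, add_smul]
    · simp [hc]
  · simp [hj, e, Pi.single_apply]

lemma col_flip (x : V d) (i j : Fin d) :
    col D (x + e j) i = col D x i + if D.sd j = D.sd i ∧ j ≠ i then 1 else 0 := by
  have h : (if D.sd j = D.sd i ∧ j ≠ i then (1 : ZMod 2) else 0) =
      ∑ q, if q = j then (if D.sd q = D.sd i ∧ q ≠ i then (1 : ZMod 2) else 0) else 0 := by
    rw [Finset.sum_ite_eq']; simp
  rw [h, col, col, ← Finset.sum_add_distrib]
  refine Finset.sum_congr rfl fun q _ => ?_
  by_cases hq : q = j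
  · subst hq
    by_cases hc : D.sd q = D.sd i ∧ q ≠ i
    · simp [hc, e]
    · simp only [hc, if_false]; simp
  · simp [hq, e, Pi.single_apply]

lemma syn_flip_self (x : V d) (i : Fin d) :
    syn D (D.sd i) (D.ty i) (D.bl i) (x + e i) = syn D (D.sd i) (D.ty i) (D.bl i) x + D.lb i := by
  rw [syn_flip]; simp

lemma syn_flip_other (s : Bool) (t : ZMod 2) (k : Fin n) (x : V d) (i : Fin d)
    (h : ¬ (D.sd i = s ∧ D.ty i = t ∧ D.bl i = k)) :
    syn D s t k (x + e i) = syn D s t k x := by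
  rw [syn_flip, if_neg h, add_zero]

/-- Some block of the given group has zero syndrome. -/
def N (s : Bool) (t : ZMod 2) (x : V d) : Prop := ∃ k, syn D s t k x = 0

/-- No block of the given side has zero syndrome. -/
def Gen (s : Bool) (x : V d) : Prop := ∀ t, ¬ N D s t x

lemma N_flip (s : Bool) (t : ZMod 2) (x : V d) (i : Fin d) (h : ¬ (D.sd i = s ∧ D.ty i = t)) :
    N D s t (x + e i) ↔ N D s t x := by
  unfold N
  refine exists_congr fun k => ?_
  rw [syn_flip_other]
  tauto

lemma Gen_flip (s : Bool) (x : V d) (i : Fin d) (h : D.sd i ≠ s) :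
    Gen D s (x + e i) ↔ Gen D s x := by
  unfold Gen
  refine forall_congr' fun t => ?_
  rw [N_flip]
  tauto

/-- Star edges. -/
def HE (x : V d) (i : Fin d) : Prop :=
  D.sec (D.sd i) (D.ty i) (D.bl i) (D.lb i) = i ∧ D.lb i ≠ 0 ∧
  (syn D (D.sd i) (D.ty i) (D.bl i) x = 0 ∨ syn D (D.sd i) (D.ty i) (D.bl i) x = D.lb i) ∧
  ¬ N D (D.sd i) (D.ty i + 1) x ∧ Gen D (!(D.sd i)) x

/-- Fibre edges. -/
def FE (x : V d) (i : Fin d) : Prop :=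
  N D (!(D.sd i)) (col D x i) x ∧ ¬ N D (!(D.sd i)) (col D x i + 1) x ∧
  Gen D (D.sd i) x ∧ Gen D (D.sd i) (x + e i)

lemma HE_flip (x : V d) (i : Fin d) (h : HE D x i) : HE D (x + e i) i := by
  obtain ⟨h1, h2, h3, h4, h5⟩ := h
  refine ⟨h1, h2, ?_, ?_, ?_⟩
  · rw [syn_flip_self]
    rcases h3 with h3 | h3
    · right; rw [h3, zero_add]
    · left; rw [h3, v_add_self]
  · rw [N_flip]
    · exact h4
    · rintro ⟨-, h⟩; exact z2_ne_succ _ h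
  · rw [Gen_flip]
    · exact h5
    · simp

lemma FE_flip (x : V d) (i : Fin d) (h : FE D x i) : FE D (x + e i) i := by
  obtain ⟨h1, h2, h3, h4⟩ := h
  have hc : col D (x + e i) i = col D x i := by rw [col_flip]; simp
  refine ⟨?_, ?_, h4, ?_⟩
  · rw [hc, N_flip]
    · exact h1
    · simp
  · rw [hc, N_flip]
    · exact h2
    · simp
  · rw [v_add_add]; exact h3

/-- The graph. -/
def G : SimpleGraph (V d) where
  Adj x y := ∃ i, y = x + e i ∧ (HE D x i ∨ FE D x i)
  symm := ⟨by
    rintro x y ⟨i, rfl, h⟩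
    exact ⟨i, (v_add_add _ _).symm, h.imp (HE_flip D x i) (FE_flip D x i)⟩⟩
  loopless := ⟨by
    rintro x ⟨i, h, -⟩
    exact e_ne_zero i (by simpa using h.symm)⟩

lemma G_le : G D ≤ cube d := by
  rintro x y ⟨i, h, -⟩
  exact (cube_adj _ _).2 ⟨i, h⟩

/-- A star edge meets a vertex with zero syndrome. -/
lemma HE_N (x : V d) (i : Fin d) (h : HE D x i) :
    N D (D.sd i) (D.ty i) x ∨ N D (D.sd i) (D.ty i) (x + e i) := by
  obtain ⟨-, -, h3 | h3, -, -⟩ := h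
  · exact Or.inl ⟨_, h3⟩
  · refine Or.inr ⟨D.bl i, ?_⟩
    rw [syn_flip_self, h3, v_add_self]

lemma not_FE (P : V d → Prop) (T : Finset (Fin d))
    (hP : ∀ x, P x → ∀ i ∈ T, P (x + e i))
    (hE : ∀ x, P x → ∀ i ∈ T, HE D x i ∨ FE D x i)
    {x : V d} (hx : P x) {i j : Fin d} (hi : i ∈ T) (hj : j ∈ T) (hij : i ≠ j)
    (hs : D.sd i = D.sd j) : ¬ FE D x j := by
  intro hF
  have hg : ¬ Gen D (!(D.sd j)) x := fun h => h _ hF.1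
  have hg' : ¬ Gen D (!(D.sd j)) (x + e i) := by
    rw [Gen_flip]
    · exact hg
    · rw [hs]; simp
  have hF' : FE D (x + e i) j := by
    rcases hE _ (hP x hx i hi) j hj with h | h
    · exact absurd h.2.2.2.2 hg'
    · exact h
  have hc : col D (x + e i) j = col D x j + 1 := by
    rw [col_flip, if_pos ⟨hs, hij⟩]
  have h1 := hF'.1
  rw [hc, N_flip] at h1
  · exact hF.2.1 h1
  · rw [hs]; simp

lemma HE_same (P : V d → Prop) (T : Finset (Fin d))
    (hP : ∀ x, P x → ∀ i ∈ T, P (x + e i))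
    (hE : ∀ x, P x → ∀ i ∈ T, HE D x i ∨ FE D x i)
    {x : V d} (hx : P x) {i j : Fin d} (hi : i ∈ T) (hj : j ∈ T) (hij : i ≠ j)
    (hs : D.sd i = D.sd j) : HE D x i :=
  (hE x hx i hi).resolve_right (not_FE D P T hP hE hx hj hi hij.symm hs.symm)

lemma ty_same (P : V d → Prop) (T : Finset (Fin d))
    (hP : ∀ x, P x → ∀ i ∈ T, P (x + e i))
    (hE : ∀ x, P x → ∀ i ∈ T, HE D x i ∨ FE D x i)
    {x : V d} (hx : P x) {i j : Fin d} (hi : i ∈ T) (hj : j ∈ T) (hij : i ≠ j)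
    (hs : D.sd i = D.sd j) : D.ty i = D.ty j := by
  by_contra hne
  have ht : D.ty j = D.ty i + 1 := z2_ne _ _ hne
  have h1 := HE_same D P T hP hE hx hi hj hij hs
  have h2 := HE_same D P T hP hE (hP x hx j hj) hi hj hij hs
  have h3 := HE_same D P T hP hE hx hj hi hij.symm hs.symm
  have a1 := h1.2.2.2.1
  have a2 := h2.2.2.2.1
  rw [hs, ← ht] at a1 a2
  rcases HE_N D _ _ h3 with h | h
  · exact a1 h
  · exact a2 h

lemma bl_ne (P : V d → Prop) (T : Finset (Fin d))
    (hP : ∀ x, P x → ∀ i ∈ T, P (x + e i))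
    (hE : ∀ x, P x → ∀ i ∈ T, HE D x i ∨ FE D x i)
    {x : V d} (hx : P x) {i j : Fin d} (hi : i ∈ T) (hj : j ∈ T) (hij : i ≠ j)
    (hs : D.sd i = D.sd j) : D.bl i ≠ D.bl j := by
  intro hb
  have ht := ty_same D P T hP hE hx hi hj hij hs
  have h1 := HE_same D P T hP hE hx hi hj hij hs
  have h2 := HE_same D P T hP hE (hP x hx j hj) hi hj hij hs
  have h3 := HE_same D P T hP hE hx hj hi hij.symm hs.symm
  have hl : D.lb i ≠ D.lb j := by
    intro hl
    apply hij
    rw [← h1.1, ← h3.1, hs, ht, hb, hl]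
  have a1 := h1.2.2.1
  have a2 := h2.2.2.1
  have a3 := h3.2.2.1
  rw [hs, ht, hb] at a1 a2
  rw [syn_flip_self] at a2
  rcases a3 with a3 | a3
  · rw [a3, zero_add] at a2
    rcases a2 with a2 | a2
    · exact h3.2.1 a2
    · exact hl a2.symm
  · rcases a1 with a1 | a1
    · exact h3.2.1 (by rw [← a3, a1])
    · exact hl (by rw [← a3, a1])

/-- Case with both sides present: `s` is the side with star edges. -/
lemma mixed (P : V d → Prop) (T : Finset (Fin d))
    (hP : ∀ x, P x → ∀ i ∈ T, P (x + e i))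
    (hE : ∀ x, P x → ∀ i ∈ T, HE D x i ∨ FE D x i)
    {x : V d} (hx : P x) (hT : T.card = n + 1) (hn : 1 ≤ n) {j : Fin d} (hj : j ∈ T)
    (hF : FE D x j) : False := by
  have hside : ∀ i ∈ T, i ≠ j → D.sd i = !(D.sd j) := by
    intro i hi hij
    by_contra h
    have hs : D.sd i = D.sd j := by
      revert h; cases D.sd i <;> cases D.sd j <;> simp
    exact not_FE D P T hP hE hx hi hj hij hs hF
  set s := !(D.sd j) with hsdef
  set c := col D x j with hc
  -- propagate along the flips
  let P' : V d → Prop := fun y => P y ∧ col D y j = c ∧ Gen D (D.sd j) y ∧ ¬ Gen D s y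
  have hP'x : P' x := ⟨hx, rfl, hF.2.2.1, fun h => h _ hF.1⟩
  have hstep : ∀ y, P' y → ∀ i ∈ T, i ≠ j → P' (y + e i) ∧ HE D y i := by
    rintro y ⟨y1, y2, y3, y4⟩ i hi hij
    have hsi := hside i hi hij
    have hne : D.sd i ≠ D.sd j := by rw [hsi, hsdef]; simp
    have hnot : (!(D.sd i)) = D.sd j := by rw [hsi, hsdef]; simp
    have hHi : HE D y i := by
      rcases hE y y1 i hi with h | h
      · exact h
      · exact absurd h.1 (by rw [hnot]; exact y3 _)
    have y3' : Gen D (D.sd j) (y + e i) := (Gen_flip D _ _ _ hne).2 y3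
    refine ⟨⟨hP y y1 i hi, ?_, y3', ?_⟩, hHi⟩
    · rw [col_flip, if_neg (by tauto), add_zero, y2]
    · intro hg
      -- then the edge `j` at `y + e i` would be a star edge
      have h1 : HE D (y + e i) j := by
        rcases hE _ (hP y y1 i hi) j hj with h | h
        · exact h
        · exact absurd h.1 (hg _)
      have h2 : FE D y j := by
        rcases hE y y1 j hj with h | h
        · exact absurd h.2.2.2.2 y4
        · exact h
      rcases HE_N D _ _ h1 with h | h
      · exact y3' _ h
      · have hcomm : y + e i + e j = y + e j + e i := by
          rw [add_assoc, add_comm (e i), ← add_assoc]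
        rw [hcomm] at h
        exact (Gen_flip D _ _ _ hne).2 h2.2.2.2 _ h
  have hN : ∀ y, P' y → N D s c y ∧ ¬ N D s (c + 1) y := by
    rintro y ⟨y1, y2, y3, y4⟩
    rcases hE y y1 j hj with h | h
    · exact absurd h.2.2.2.2 y4
    · have a := h.1
      have b := h.2.1
      rw [y2] at a b
      exact ⟨a, b⟩
  have hty : ∀ i ∈ T, i ≠ j → D.ty i = c := by
    intro i hi hij
    obtain ⟨q1, q2⟩ := hstep x hP'x i hi hij
    by_contra hne
    have h3 := z2_ne _ _ (Ne.symm hne)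
    rcases HE_N D _ _ q2 with h | h
    · rw [hside i hi hij, h3] at h; exact (hN x hP'x).2 h
    · rw [hside i hi hij, h3] at h; exact (hN _ q1).2 h
  have hsurj : ∀ k : Fin n, ∃ i ∈ T, i ≠ j ∧ D.bl i = k := by
    have hcard : (T.erase j).card = n := by rw [Finset.card_erase_of_mem hj, hT]; rfl
    have hinj : Set.InjOn D.bl (T.erase j : Finset (Fin d)) := by
      intro a ha b hb hab
      rw [Finset.mem_coe, Finset.mem_erase] at ha hb
      by_contra hne
      exact bl_ne D P T hP hE hx ha.2 hb.2 hne
        (by rw [hside a ha.2 ha.1, hside b hb.2 hb.1]) hab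
    have himg : (T.erase j).image D.bl = Finset.univ := by
      apply Finset.eq_univ_of_card
      rw [Finset.card_image_of_injOn hinj, hcard, Fintype.card_fin]
    intro k
    have hk : k ∈ (T.erase j).image D.bl := by rw [himg]; exact Finset.mem_univ _
    obtain ⟨i, hi, hik⟩ := Finset.mem_image.1 hk
    rw [Finset.mem_erase] at hi
    exact ⟨i, hi.2, hi.1, hik⟩
  have key : ∀ K : Finset (Fin n), ∃ y, P' y ∧ ∀ k ∈ K, syn D s c k y ≠ 0 := by
    intro K
    induction K using Finset.induction_on with
    | empty => exact ⟨x, hP'x, by simp⟩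
    | insert k K hk ih =>
      obtain ⟨y, hy, hyK⟩ := ih
      by_cases h0 : syn D s c k y = 0
      · obtain ⟨i, hi, hij, hik⟩ := hsurj k
        obtain ⟨q1, q2⟩ := hstep y hy i hi hij
        refine ⟨y + e i, q1, ?_⟩
        intro k' hk'
        rw [Finset.mem_insert] at hk'
        rcases hk' with rfl | hk'
        · rw [syn_flip, if_pos ⟨hside i hi hij, hty i hi hij, hik⟩, h0, zero_add]
          exact q2.2.1
        · rw [syn_flip_other]
          · exact hyK k' hk'
          · rintro ⟨-, -, h⟩
            rw [hik] at h
            exact hk (h ▸ hk')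
      · refine ⟨y, hy, ?_⟩
        intro k' hk'
        rw [Finset.mem_insert] at hk'
        rcases hk' with rfl | hk'
        · exact h0
        · exact hyK k' hk'
  obtain ⟨y, hy, hyK⟩ := key Finset.univ
  obtain ⟨k, hk⟩ := (hN y hy).1
  exact hyK k (Finset.mem_univ _) hk

lemma free_aux (P : V d → Prop) (T : Finset (Fin d))
    (hP : ∀ x, P x → ∀ i ∈ T, P (x + e i))
    (hE : ∀ x, P x → ∀ i ∈ T, HE D x i ∨ FE D x i)
    {x : V d} (hx : P x) (hT : T.card = n + 1) (hn : 1 ≤ n) : False := by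
  have hH : ∀ y, P y → ∀ i ∈ T, HE D y i := by
    intro y hy i hi
    exact (hE y hy i hi).resolve_right (fun h => mixed D P T hP hE hy hT hn hi h)
  -- all on the same side
  have hs : ∀ i ∈ T, ∀ j ∈ T, D.sd i = D.sd j := by
    intro i hi j hj
    by_contra hne
    have hsj : (!(D.sd i)) = D.sd j := by
      revert hne; cases D.sd i <;> cases D.sd j <;> simp
    have h1 := (hH x hx i hi).2.2.2.2
    have h2 := (hH _ (hP x hx j hj) i hi).2.2.2.2
    rw [hsj] at h1 h2
    rcases HE_N D _ _ (hH x hx j hj) with h | h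
    · exact h1 _ h
    · exact h2 _ h
  have hinj : Set.InjOn D.bl (T : Finset (Fin d)) := by
    intro a ha b hb hab
    by_contra hne
    exact bl_ne D P T hP hE hx ha hb hne (hs a ha b hb) hab
  have h1 := Finset.card_image_of_injOn hinj
  have h2 := Finset.card_le_univ (T.image D.bl)
  rw [h1, hT, Fintype.card_fin] at h2
  omega

lemma G_free (hn : 1 ≤ n) : ¬ ContainsCopy (cube (n + 1)) (G D) := by
  rintro ⟨f, hf, hadj⟩
  obtain ⟨δ, hδ, hfl⟩ := copy_structure f hf (fun a b h => G_le D (hadj h))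
  refine free_aux D (fun x => ∃ a, f a = x) (Finset.univ.image δ) ?_ ?_ (x := f 0) ⟨0, rfl⟩ ?_ hn
  · rintro x ⟨a, rfl⟩ i hi
    obtain ⟨j, -, rfl⟩ := Finset.mem_image.1 hi
    exact ⟨a + e j, hfl a j⟩
  · rintro x ⟨a, rfl⟩ i hi
    obtain ⟨j, -, rfl⟩ := Finset.mem_image.1 hi
    obtain ⟨i, h1, h2⟩ := hadj ((cube_adj a (a + e j)).2 ⟨j, rfl⟩)
    rw [hfl] at h1
    rw [e_inj (add_left_cancel h1)]
    exact h2
  · rw [Finset.card_image_of_injective _ hδ]; simp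

/-- All blocks have nonzero syndrome. -/
def AG (x : V d) : Prop := ∀ s, Gen D s x

lemma service (x : V d) (i : Fin d) (hx : AG D x) (hy : AG D (x + e i)) :
    ContainsCopy (cube (n + 1)) (G D ⊔ SimpleGraph.fromEdgeSet {s(x, x + e i)}) := by
  classical
  set s := D.sd i with hs
  set c := col D x i with hc
  let J : Fin n → Fin d := fun k => D.sec (!s) c k (syn D (!s) c k x)
  let δ : Fin (n + 1) → Fin d := Fin.cons i J
  have hJsd : ∀ k, D.sd (J k) = !s := fun k => D.sd_sec _ _ _ _
  have hJty : ∀ k, D.ty (J k) = c := fun k => D.ty_sec _ _ _ _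
  have hJbl : ∀ k, D.bl (J k) = k := fun k => D.bl_sec _ _ _ _
  have hJlb : ∀ k, D.lb (J k) = syn D (!s) c k x := fun k => D.lb_sec _ _ _ _
  have hJinj : Function.Injective J := fun a b h => by
    rw [← hJbl a, ← hJbl b, h]
  have hiJ : ∀ k, J k ≠ i := by
    intro k h
    have := hJsd k
    rw [h, ← hs] at this
    revert this; cases s <;> simp
  have hδ : Function.Injective δ := by
    rw [Fin.cons_injective_iff]
    exact ⟨by rintro ⟨k, hk⟩; exact hiJ k hk, hJinj⟩
  let f : V (n + 1) → V d := fun a => x + ∑ l, Pi.single (δ l) (a l)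
  have hf0 : f 0 = x := by simp [f]
  have hfl : ∀ a l, f (a + e l) = f a + e (δ l) := by
    intro a l
    simp only [f, add_assoc, Pi.add_apply, Pi.single_add, Finset.sum_add_distrib]
    congr 2
    rw [Finset.sum_eq_single l]
    · simp [e]
    · intro b _ hb
      simp [e, hb]
    · simp
  have hfinj : Function.Injective f := by
    intro a b hab
    have h1 := add_left_cancel hab
    funext l
    have h2 := congrFun h1 (δ l)
    simpa [Finset.sum_apply, Pi.single_apply, hδ.eq_iff] using h2
  -- invariants
  have inv : ∀ a, (∀ k, syn D (!s) c k (f a) = syn D (!s) c k x + a k.succ • syn D (!s) c k x) ∧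
      (¬ N D (!s) (c + 1) (f a)) ∧ (Gen D s (f a)) ∧ (col D (f a) i = c) ∧
      (Gen D s (f a + e i)) := by
    intro a
    refine cube_induction (fun a => (∀ k, syn D (!s) c k (f a) =
      syn D (!s) c k x + a k.succ • syn D (!s) c k x) ∧
      (¬ N D (!s) (c + 1) (f a)) ∧ (Gen D s (f a)) ∧ (col D (f a) i = c) ∧
      (Gen D s (f a + e i))) ?_ ?_ a
    · rw [hf0]
      exact ⟨by simp, hx _ _, hx _, rfl, hy _⟩
    · rintro a l ⟨h1, h2, h3, h4, h5⟩
      rw [hfl]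
      refine Fin.cases ?_ (fun k => ?_) l
      · have hd0 : δ 0 = i := rfl
        rw [hd0]
        refine ⟨?_, ?_, h5, ?_, ?_⟩
        · intro k
          rw [syn_flip_other, h1 k]
          · simp [e]
          · rintro ⟨h, -⟩; rw [← hs] at h; revert h; cases s <;> simp
        · rw [N_flip]
          · exact h2
          · rintro ⟨h, -⟩; rw [← hs] at h; revert h; cases s <;> simp
        · rw [col_flip]; simpa using h4
        · rw [v_add_add]; exact h3
      · have hdk : δ k.succ = J k := rfl
        rw [hdk]
        have hsne : D.sd (J k) ≠ s := by rw [hJsd]; simp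
        refine ⟨?_, ?_, ?_, ?_, ?_⟩
        · intro k'
          by_cases hk : k' = k
          · subst hk
            rw [syn_flip, if_pos ⟨hJsd _, hJty _, hJbl _⟩, h1 k', hJlb]
            simp [e, add_smul, add_assoc]
          · rw [syn_flip_other, h1 k']
            · simp [e, hk]
            · rintro ⟨-, -, h⟩; rw [hJbl] at h; exact hk h.symm
        · rw [N_flip]
          · exact h2
          · rintro ⟨-, h⟩; rw [hJty] at h; exact z2_ne_succ _ h
        · rw [Gen_flip _ _ _ _ hsne]; exact h3
        · rw [col_flip, if_neg (by rw [← hs]; tauto), add_zero, h4]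
        · rw [add_assoc, add_comm (e (J k)), ← add_assoc, Gen_flip _ _ _ _ hsne]; exact h5
  refine ⟨f, hfinj, ?_⟩
  intro a b hab
  obtain ⟨l, rfl⟩ := (cube_adj _ _).1 hab
  rw [hfl]
  obtain ⟨h1, h2, h3, h4, h5⟩ := inv a
  revert hab
  refine Fin.cases ?_ (fun k => ?_) l
  · intro _
    have hd0 : δ 0 = i := rfl
    rw [hd0]
    by_cases hall : ∀ k : Fin n, a k.succ = 0
    · right
      rw [SimpleGraph.fromEdgeSet_adj]
      have hne : f a ≠ f a + e i := fun h => e_ne_zero i (by simpa using h.symm)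
      refine ⟨?_, hne⟩
      rw [Set.mem_singleton_iff]
      rcases z2_cases (a 0) with h0 | h0
      · have : a = 0 := by
          funext l; refine Fin.cases h0 (fun k => hall k) l
        rw [this, hf0]
      · have : a = 0 + e 0 := by
          funext l
          refine Fin.cases ?_ (fun k => ?_) l
          · simp [h0, e]
          · simp [hall k, e]
        rw [this, hfl, hf0, hd0, v_add_add, Sym2.eq_swap]
    · left
      push Not at hall
      obtain ⟨k, hk⟩ := hall
      refine ⟨i, rfl, Or.inr ⟨?_, ?_, h3, h5⟩⟩
      · rw [h4]
        refine ⟨k, ?_⟩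
        rw [← hs, h1 k, (z2_cases _).resolve_left hk, one_smul, v_add_self]
      · rw [h4]; exact h2
  · intro _
    have hdk : δ k.succ = J k := rfl
    rw [hdk]
    left
    refine ⟨J k, rfl, Or.inl ⟨?_, ?_, ?_, ?_, ?_⟩⟩
    · rw [hJsd, hJty, hJbl, hJlb]
    · rw [hJlb]
      intro h
      exact hx _ _ ⟨k, h⟩
    · rw [hJsd, hJty, hJbl, hJlb, h1 k]
      rcases z2_cases (a k.succ) with h | h
      · right; rw [h]; simp
      · left; rw [h, one_smul, v_add_self]
    · rw [hJsd, hJty]; exact h2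
    · rw [hJsd, Bool.not_not]; exact h3

lemma ContainsCopy.mono {α β : Type*} {H : SimpleGraph α} {A B : SimpleGraph β} (h : A ≤ B)
    (hA : ContainsCopy H A) : ContainsCopy H B := by
  obtain ⟨f, h1, h2⟩ := hA
  exact ⟨f, h1, fun a b hab => h (h2 hab)⟩

lemma exists_saturated {α β : Type*} [Finite β] (F A : SimpleGraph β) (H : SimpleGraph α)
    (hA : A ≤ F) (hfree : ¬ ContainsCopy H A) : ∃ B, A ≤ B ∧ Saturated F B H := by
  have hfin : {B : SimpleGraph β | B ≤ F ∧ ¬ ContainsCopy H B}.Finite := Set.toFinite _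
  obtain ⟨B, hAB, hB⟩ := hfin.exists_le_maximal (a := A) ⟨hA, hfree⟩
  refine ⟨B, hAB, hB.prop.1, hB.prop.2, ?_⟩
  intro u v huv hnot
  by_contra hc
  have hle : B ⊔ SimpleGraph.fromEdgeSet {s(u, v)} ≤ F := by
    refine sup_le hB.prop.1 ?_
    intro a b hab
    rw [SimpleGraph.fromEdgeSet_adj, Set.mem_singleton_iff, Sym2.eq_iff] at hab
    rcases hab.1 with ⟨rfl, rfl⟩ | ⟨rfl, rfl⟩
    · exact huv
    · exact huv.symm
  have h2 := hB.le_of_ge ⟨hle, hc⟩ le_sup_left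
  apply hnot
  apply h2
  right
  rw [SimpleGraph.fromEdgeSet_adj]
  exact ⟨rfl, huv.ne⟩

/-- Edge count by a set of vertices meeting all edges. -/
lemma edge_count (B : SimpleGraph (V d)) (hB : B ≤ cube d) (X : Finset (V d))
    (hX : ∀ x i, B.Adj x (x + e i) → x ∈ X ∨ x + e i ∈ X) :
    B.edgeSet.ncard ≤ X.card * d := by
  classical
  have hsub : B.edgeSet ⊆
      (((X ×ˢ (Finset.univ : Finset (Fin d))).image (fun p => s(p.1, p.1 + e p.2)) :
        Finset (Sym2 (V d))) : Set (Sym2 (V d))) := by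
    intro z
    induction z using Sym2.ind with
    | _ u v =>
      intro h
      rw [SimpleGraph.mem_edgeSet] at h
      obtain ⟨i, rfl⟩ := (cube_adj _ _).1 (hB h)
      rw [Finset.mem_coe, Finset.mem_image]
      rcases hX u i h with h1 | h1
      · exact ⟨(u, i), by simp [h1], rfl⟩
      · refine ⟨(u + e i, i), by simp [h1], ?_⟩
        simp only [v_add_add]
        exact Sym2.eq_swap
  calc B.edgeSet.ncard ≤ _ := Set.ncard_le_ncard hsub (Finset.finite_toSet _)
    _ ≤ (X ×ˢ (Finset.univ : Finset (Fin d))).card := by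
        rw [Set.ncard_coe_finset]; exact Finset.card_image_le
    _ = X.card * d := by rw [Finset.card_product]; simp

lemma satNum_le {α : Type*} (H : SimpleGraph α) (A : SimpleGraph (V d)) (hA : A ≤ cube d)
    (hfree : ¬ ContainsCopy H A) (X : Finset (V d))
    (hX : ∀ x i, x ∉ X → x + e i ∉ X →
      ContainsCopy H (A ⊔ SimpleGraph.fromEdgeSet {s(x, x + e i)})) :
    satNum (cube d) H ≤ X.card * d := by
  obtain ⟨B, hAB, hB⟩ := exists_saturated _ A H hA hfree
  refine le_trans (Nat.sInf_le ⟨B, hB, rfl⟩) ?_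
  refine edge_count B hB.1 X ?_
  intro x i hadj
  by_contra hc
  push Not at hc
  refine hB.2.1 (ContainsCopy.mono (sup_le hAB ?_) (hX x i hc.1 hc.2))
  intro a b hab
  rw [SimpleGraph.fromEdgeSet_adj, Set.mem_singleton_iff, Sym2.eq_iff] at hab
  rcases hab.1 with ⟨rfl, rfl⟩ | ⟨rfl, rfl⟩
  · exact hadj
  · exact hadj.symm

open Classical in
lemma zero_count (s : Bool) (t : ZMod 2) (k : Fin n) :
    (Finset.univ.filter (fun x : V d => syn D s t k x = 0)).card * 2 ^ r ≤ 2 ^ d := by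
  have h := Finset.card_le_card_of_injOn
    (s := (Finset.univ.filter (fun x : V d => syn D s t k x = 0)) ×ˢ (Finset.univ : Finset (V r)))
    (t := (Finset.univ : Finset (V d)))
    (fun p => p.1 + e (D.sec s t k p.2)) (fun _ _ => Finset.mem_coe.2 (Finset.mem_univ _)) ?_
  · rw [Finset.card_product] at h
    simpa [ZMod.card] using h
  · rintro ⟨x, v⟩ hx ⟨y, w⟩ hy hxy
    have hx0 : syn D s t k x = 0 := by simpa using hx
    have hy0 : syn D s t k y = 0 := by simpa using hy
    simp only at hxy
    have h1 := congrArg (syn D s t k) hxy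
    rw [syn_flip, syn_flip, if_pos ⟨D.sd_sec _ _ _ _, D.ty_sec _ _ _ _, D.bl_sec _ _ _ _⟩,
      if_pos ⟨D.sd_sec _ _ _ _, D.ty_sec _ _ _ _, D.bl_sec _ _ _ _⟩, hx0, hy0, zero_add,
      zero_add, D.lb_sec, D.lb_sec] at h1
    subst h1
    rw [add_right_cancel hxy]

open Classical in
lemma AG_count : (Finset.univ.filter (fun x : V d => ¬ AG D x)).card * 2 ^ r ≤
    4 * n * 2 ^ d := by
  have hsub : Finset.univ.filter (fun x : V d => ¬ AG D x) ⊆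
      (Finset.univ : Finset (Bool × ZMod 2 × Fin n)).biUnion
        (fun q => Finset.univ.filter (fun x : V d => syn D q.1 q.2.1 q.2.2 x = 0)) := by
    intro x hx
    rw [Finset.mem_filter] at hx
    have hx2 := hx.2
    unfold AG Gen N at hx2
    push Not at hx2
    obtain ⟨s, t, k, h⟩ := hx2
    rw [Finset.mem_biUnion]
    exact ⟨(s, t, k), Finset.mem_univ _, by simpa using h⟩
  calc _ ≤ (∑ q : Bool × ZMod 2 × Fin n,
        (Finset.univ.filter (fun x : V d => syn D q.1 q.2.1 q.2.2 x = 0)).card) * 2 ^ r :=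
        Nat.mul_le_mul_right _ ((Finset.card_le_card hsub).trans Finset.card_biUnion_le)
    _ = ∑ q : Bool × ZMod 2 × Fin n,
        (Finset.univ.filter (fun x : V d => syn D q.1 q.2.1 q.2.2 x = 0)).card * 2 ^ r :=
        Finset.sum_mul _ _ _
    _ ≤ ∑ q : Bool × ZMod 2 × Fin n, 2 ^ d := Finset.sum_le_sum fun q _ => zero_count D _ _ _
    _ = 4 * n * 2 ^ d := by
        simp [Fintype.card_prod, ZMod.card]
        ring

/-- The labels exist as soon as there are enough coordinates. -/
lemma exists_dat (d n r : ℕ) (hn : 1 ≤ n) (h : 4 * n * 2 ^ r ≤ d) : Nonempty (Dat d n r) := by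
  have hcard : Fintype.card (Bool × ZMod 2 × Fin n × V r) ≤ Fintype.card (Fin d) := by
    simp only [Fintype.card_prod, Fintype.card_bool, ZMod.card, Fintype.card_fin,
      Fintype.card_fun]
    calc _ = 4 * n * 2 ^ r := by ring
      _ ≤ d := h
  obtain ⟨ι⟩ := Function.Embedding.nonempty_of_card_le hcard
  haveI : Nonempty (Bool × ZMod 2 × Fin n × V r) := ⟨(true, 0, ⟨0, hn⟩, 0)⟩
  let p := Function.invFun ι
  have hp : ∀ q, p (ι q) = q := Function.leftInverse_invFun ι.injective
  exact ⟨{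
    sd := fun i => (p i).1
    ty := fun i => (p i).2.1
    bl := fun i => (p i).2.2.1
    lb := fun i => (p i).2.2.2
    sec := fun s t k v => ι (s, t, k, v)
    sd_sec := fun s t k v => by rw [hp]
    ty_sec := fun s t k v => by rw [hp]
    bl_sec := fun s t k v => by rw [hp]
    lb_sec := fun s t k v => by rw [hp] }⟩

lemma bot_free (n : ℕ) : ¬ ContainsCopy (cube (n + 1)) (⊥ : SimpleGraph (V d)) := by
  rintro ⟨f, -, h⟩
  exact h ((cube_adj (0 : V (n + 1)) (0 + e 0)).2 ⟨0, rfl⟩)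

lemma main_bound (d n : ℕ) (hn : 1 ≤ n) :
    satNum (cube d) (cube (n + 1)) ≤ 72 * (n + 1) ^ 2 * 2 ^ d := by
  classical
  by_cases hd : d < 4 * n
  · have h := satNum_le (cube (n + 1)) (⊥ : SimpleGraph (V d)) bot_le (bot_free n)
      Finset.univ (fun x i hx => absurd (Finset.mem_univ _) hx)
    have hc : (Finset.univ : Finset (V d)).card = 2 ^ d := by simp [ZMod.card]
    rw [hc] at h
    refine h.trans ?_
    rw [mul_comm]
    exact Nat.mul_le_mul_right _ (by nlinarith)
  · push Not at hd
    have hpos : 0 < 4 * n := by omega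
    set r := Nat.log 2 (d / (4 * n)) with hr
    have hq : d / (4 * n) ≠ 0 := (Nat.div_pos hd hpos).ne'
    have h1 : 4 * n * 2 ^ r ≤ d := by
      have := Nat.pow_log_le_self 2 hq
      rw [mul_comm]
      exact (Nat.le_div_iff_mul_le hpos).1 this
    have h2 : d < 2 ^ (r + 1) * (4 * n) := by
      have := Nat.lt_pow_succ_log_self (b := 2) (by norm_num) (d / (4 * n))
      exact (Nat.div_lt_iff_lt_mul hpos).1 this
    obtain ⟨D⟩ := exists_dat d n r hn h1
    have h3 := satNum_le (cube (n + 1)) (G D) (G_le D) (G_free D hn)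
      (Finset.univ.filter (fun x : V d => ¬ AG D x)) (by
        intro x i hx hy
        exact service D x i (by simpa using hx) (by simpa using hy))
    have h4 := AG_count D
    refine h3.trans ?_
    calc _ ≤ (Finset.univ.filter (fun x : V d => ¬ AG D x)).card * (2 ^ (r + 1) * (4 * n)) :=
          Nat.mul_le_mul_left _ h2.le
      _ = ((Finset.univ.filter (fun x : V d => ¬ AG D x)).card * 2 ^ r) * (8 * n) := by ring
      _ ≤ (4 * n * 2 ^ d) * (8 * n) := Nat.mul_le_mul_right _ h4
      _ = 32 * n ^ 2 * 2 ^ d := by ring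
      _ ≤ _ := Nat.mul_le_mul_right _ (by nlinarith)

end SatCube

theorem stmt_11 (m : ℕ) (hm : 2 ≤ m) :
    (∀ ε : ℝ, 0 < ε → ∃ D : ℕ, ∀ d ≥ D,
      (satNum (cube d) (cube m) : ℝ) ≤ (1 + ε) * (72 * m ^ 2 * 2 ^ d)) ∧
    ∃ c : ℝ, ∀ d : ℕ, (satNum (cube d) (cube m) : ℝ) ≤ c * 2 ^ d := by
  have key : ∀ d : ℕ, (satNum (cube d) (cube m) : ℝ) ≤ 72 * m ^ 2 * 2 ^ d := by
    intro d
    obtain ⟨n, rfl⟩ : ∃ n, m = n + 1 := ⟨m - 1, by omega⟩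
    exact_mod_cast SatCube.main_bound d n (by omega)
  refine ⟨fun ε hε => ⟨0, fun d _ => (key d).trans ?_⟩, 72 * m ^ 2, key⟩
  have : (0 : ℝ) ≤ 72 * m ^ 2 * 2 ^ d := by positivity
  nlinarith
end

section
/- For d = ℓ ≥ 2, there exists a spanning tree of the hypercube Q_ℓ which is weakly (Q_ℓ, C_{2ℓ})-saturated, so wsat(Q_ℓ, C_{2ℓ}) = 2^ℓ − 1. -/
open SimpleGraph Finset

namespace CubeSat

/-- There is a path of length `k` from `u` to `v` in `G`. -/
def HasP {V : Type*} (G : SimpleGraph V) (u v : V) (k : ℕ) : Prop :=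
  ∃ p : G.Walk u v, p.IsPath ∧ p.length = k

/-- `G` is closed inside `F` under completing paths of length `k` by an edge of `F`. -/
def Closed {V : Type*} (F G : SimpleGraph V) (k : ℕ) : Prop :=
  ∀ u v, F.Adj u v → HasP G u v k → G.Adj u v

lemma HasP.symm {V : Type*} {G : SimpleGraph V} {u v : V} {k : ℕ} (h : HasP G u v k) :
    HasP G v u k := by
  obtain ⟨p, hp, hk⟩ := h
  exact ⟨p.reverse, hp.reverse, by simpa using hk⟩

lemma HasP.map {V W : Type*} {G : SimpleGraph V} {G' : SimpleGraph W} (f : G →g G')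
    (hf : Function.Injective f) {u v : V} {k : ℕ} (h : HasP G u v k) :
    HasP G' (f u) (f v) k := by
  obtain ⟨p, hp, hk⟩ := h
  exact ⟨p.map f, hp.map hf, by simpa using hk⟩

lemma copyAt_of_hasP {V : Type*} {G : SimpleGraph V} {u v : V} {l : ℕ} (hl : 2 ≤ l) (huv : u ≠ v)
    (h : HasP G u v (2 * l - 1)) :
    CopyAt (cycleGraph (2 * l)) (G ⊔ SimpleGraph.fromEdgeSet {s(u, v)}) u v := by
  obtain ⟨p, hp, hk⟩ := h
  have key : ∀ a b : Fin (2 * l), (b - a).val = 1 →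
      (G ⊔ SimpleGraph.fromEdgeSet {s(u, v)}).Adj (p.getVert a) (p.getVert b) := by
    intro a b hab
    have ha := a.2
    have hb := b.2
    rw [Fin.sub_def] at hab
    simp only at hab
    by_cases hlt : (a : ℕ) + 1 < 2 * l
    · have : (b : ℕ) = a + 1 := by
        by_cases hba : (a : ℕ) ≤ b
        · rw [show 2 * l - (a : ℕ) + b = (b - a) + 2 * l by omega, Nat.add_mod_right,
            Nat.mod_eq_of_lt (by omega)] at hab
          omega
        · rw [Nat.mod_eq_of_lt (by omega)] at hab
          omega
      rw [this]
      exact Or.inl (p.adj_getVert_succ (by omega))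
    · have ha' : (a : ℕ) = 2 * l - 1 := by omega
      have hb' : (b : ℕ) = 0 := by
        rw [ha'] at hab
        by_contra hne
        by_cases h1 : (b : ℕ) + 1 = 2 * l
        · rw [show 2 * l - (2 * l - 1) + (b : ℕ) = 2 * l by omega, Nat.mod_self] at hab
          omega
        · rw [Nat.mod_eq_of_lt (by omega)] at hab
          omega
      rw [ha', hb', ← hk, p.getVert_length, p.getVert_zero]
      right
      rw [SimpleGraph.fromEdgeSet_adj]
      exact ⟨by simp [Sym2.eq_swap], huv.symm⟩
  refine ⟨fun i => p.getVert i, ?_, ?_, ⟨0, by omega⟩, ⟨2 * l - 1, by omega⟩, ?_, ?_, ?_⟩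
  · intro a b hab
    have ha := a.2
    have hb := b.2
    exact Fin.ext (hp.getVert_injOn (by simp; omega) (by simp; omega) hab)
  · intro a b hab
    rw [cycleGraph_adj'] at hab
    rcases hab with hab | hab
    · exact (key b a hab).symm
    · exact key a b hab
  · rw [cycleGraph_adj']
    left
    rw [Fin.sub_def]
    simp only
    rw [Nat.mod_eq_of_lt (by omega)]
    omega
  · simp
  · simp [← hk]

lemma ws_of_closed {V : Type*} [Finite V] {F T : SimpleGraph V} {l : ℕ} (hl : 2 ≤ l)
    (h : ∀ G, T ≤ G → G ≤ F → Closed F G (2 * l - 1) → G = F) (hT : T ≤ F) :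
    WeaklySaturated F T (cycleGraph (2 * l)) := by
  suffices H : ∀ (m : ℕ) (G : SimpleGraph V), T ≤ G → G ≤ F →
      (F.edgeSet \ G.edgeSet).ncard = m → WeaklySaturated F G (cycleGraph (2 * l)) from
    H _ T le_rfl hT rfl
  intro m
  induction m using Nat.strong_induction_on with
  | _ m ih =>
    intro G hTG hGF hm
    by_cases hc : Closed F G (2 * l - 1)
    · have := h G hTG hGF hc
      exact ⟨hGF, 0, fun _ => G, rfl, this, by simp⟩
    · unfold Closed at hc
      push Not at hc
      obtain ⟨u, v, huv, hp, hn⟩ := hc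
      set G' := G ⊔ SimpleGraph.fromEdgeSet {s(u, v)} with hG'
      have hGG' : G ≤ G' := le_sup_left
      have hG'F : G' ≤ F := by
        refine sup_le hGF ?_
        intro a b hab
        rw [SimpleGraph.fromEdgeSet_adj] at hab
        have h1 : s(a, b) = s(u, v) := hab.1
        rw [← SimpleGraph.mem_edgeSet, h1]
        exact huv
      have hlt : (F.edgeSet \ G'.edgeSet).ncard < m := by
        rw [← hm]
        refine Set.ncard_lt_ncard ?_ (Set.toFinite _)
        refine ⟨fun e he => ⟨he.1, fun h => he.2 (SimpleGraph.edgeSet_mono hGG' h)⟩, ?_⟩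
        intro hsub
        have := hsub (show s(u, v) ∈ F.edgeSet \ G.edgeSet from ⟨huv, hn⟩)
        refine this.2 ?_
        rw [SimpleGraph.mem_edgeSet]
        right
        rw [SimpleGraph.fromEdgeSet_adj]
        exact ⟨rfl, huv.ne⟩
      obtain ⟨-, n, seq, h0, hn', hstep⟩ := ih _ hlt G' (hTG.trans hGG') hG'F rfl
      refine ⟨hGF, n + 1, fun i => Nat.casesOn i G seq, rfl, hn', ?_⟩
      intro i hi
      cases i with
      | zero =>
        refine ⟨u, v, hn, huv, ?_, ?_⟩
        · simp [h0, hG']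
        · simp only [h0, hG']
          exact copyAt_of_hasP hl huv.ne hp
      | succ j => exact hstep j (by omega)

lemma reach_of_copy {V : Type*} {G : SimpleGraph V} {u v : V} {l : ℕ} (hl : 2 ≤ l)
    (h : CopyAt (cycleGraph (2 * l)) (G ⊔ SimpleGraph.fromEdgeSet {s(u, v)}) u v) :
    G.Reachable u v := by
  obtain ⟨f, hf, hadj, a, b, hab, rfl, rfl⟩ := h
  have key : ∀ a b : Fin (2 * l), (a - b).val = 1 →
      (∀ ⦃c d⦄, (cycleGraph (2 * l)).Adj c d →
        (G ⊔ SimpleGraph.fromEdgeSet {s(f a, f b)}).Adj (f c) (f d)) →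
      G.Reachable (f a) (f b) := by
    intro a b hab hadj
    have hpos : 0 < 2 * l := by omega
    have ha := a.2
    have hb := b.2
    let g : ℕ → Fin (2 * l) := fun k => ⟨(a + k) % (2 * l), Nat.mod_lt _ hpos⟩
    have g0 : g 0 = a := Fin.ext (by simp [g, Nat.mod_eq_of_lt ha])
    have gl : g (2 * l - 1) = b := by
      rw [Fin.sub_def] at hab
      simp only at hab
      apply Fin.ext
      simp only [g]
      have e1 : (a : ℕ) + (2 * l - 1) ≡ b [MOD 2 * l] := by
        have : (2 * l - b + a) ≡ 1 [MOD 2 * l] := by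
          unfold Nat.ModEq
          rw [hab, Nat.mod_eq_of_lt (by omega)]
        have h2 := this.add_right (b + (2 * l - 1))
        rw [show 2 * l - (b : ℕ) + a + (b + (2 * l - 1)) = a + (2 * l - 1) + 2 * l by omega,
          show 1 + ((b : ℕ) + (2 * l - 1)) = b + 2 * l by omega] at h2
        simpa [Nat.ModEq] using h2
      have := e1
      unfold Nat.ModEq at this
      rw [this, Nat.mod_eq_of_lt hb]
    have ginj : ∀ i j, i < 2 * l → j < 2 * l → g i = g j → i = j := by
      intro i j hi hj hij
      have : (a : ℕ) + i ≡ a + j [MOD 2 * l] := by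
        simpa [g, Fin.ext_iff, Nat.ModEq] using hij
      have := Nat.ModEq.add_left_cancel' _ this
      unfold Nat.ModEq at this
      rwa [Nat.mod_eq_of_lt hi, Nat.mod_eq_of_lt hj] at this
    have gadj : ∀ k, (cycleGraph (2 * l)).Adj (g k) (g (k + 1)) := by
      intro k
      rw [cycleGraph_adj']
      right
      rw [Fin.sub_def]
      simp only [g]
      have hlt := Nat.mod_lt (a + k) hpos
      rw [← Nat.add_assoc, Nat.add_mod (a + k) 1, Nat.mod_eq_of_lt (show 1 < 2 * l by omega)]
      generalize ((a : ℕ) + k) % (2 * l) = t at *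
      by_cases ht : t + 1 < 2 * l
      · rw [Nat.mod_eq_of_lt ht, show 2 * l - t + (t + 1) = 1 + 2 * l by omega, Nat.add_mod_right,
          Nat.mod_eq_of_lt (by omega)]
      · rw [show t + 1 = 2 * l by omega, Nat.mod_self, Nat.mod_eq_of_lt (by omega)]
        omega
    have step : ∀ k, k ≤ 2 * l - 1 → G.Reachable (f a) (f (g k)) := by
      intro k
      induction k with
      | zero => intro _; rw [g0]
      | succ k ih =>
        intro hk
        refine (ih (by omega)).trans ?_
        rcases hadj (gadj k) with h | h
        · exact h.reachable
        · exfalso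
          rw [SimpleGraph.fromEdgeSet_adj] at h
          have h1 : s(f (g k), f (g (k + 1))) = s(f a, f b) := h.1
          rw [← g0, ← gl, Sym2.eq_iff] at h1
          rcases h1 with ⟨h1, h2⟩ | ⟨h1, h2⟩
          · have := ginj _ _ (by omega) (by omega) (hf h1)
            have := ginj _ _ (by omega) (by omega) (hf h2)
            omega
          · have := ginj _ _ (by omega) (by omega) (hf h1)
            omega
    have := step _ le_rfl
    rwa [gl] at this
  rw [cycleGraph_adj'] at hab
  rcases hab with hab | hab
  · exact key a b hab hadj
  · refine (key b a hab ?_).symm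
    rw [Sym2.eq_swap]
    exact hadj

lemma connected_of_ws {V : Type*} {F G : SimpleGraph V} {l : ℕ} (hl : 2 ≤ l)
    (hF : F.Connected) (h : WeaklySaturated F G (cycleGraph (2 * l))) : G.Connected := by
  obtain ⟨-, n, seq, h0, hn, hstep⟩ := h
  have : ∀ k, k ≤ n → (seq (n - k)).Connected := by
    intro k
    induction k with
    | zero => intro _; simpa [hn] using hF
    | succ k ih =>
      intro hk
      have hc := ih (by omega)
      obtain ⟨u, v, -, -, hs, hcopy⟩ := hstep (n - (k + 1)) (by omega)
      rw [show n - k = n - (k + 1) + 1 by omega] at hc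
      rw [hs] at hc hcopy
      have hr := reach_of_copy hl hcopy
      have := hc.nonempty
      refine ⟨fun x y => ?_⟩
      obtain ⟨p⟩ := hc.preconnected x y
      induction p with
      | nil => exact SimpleGraph.Reachable.refl _
      | cons hadj p ih' =>
        refine SimpleGraph.Reachable.trans ?_ ih'
        rcases hadj with h | h
        · exact h.reachable
        · rw [SimpleGraph.fromEdgeSet_adj] at h
          have h1 : s(_, _) = s(u, v) := h.1
          rw [Sym2.eq_iff] at h1
          rcases h1 with ⟨rfl, rfl⟩ | ⟨rfl, rfl⟩
          · exact hr
          · exact hr.symm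
  have := this n le_rfl
  rwa [Nat.sub_self, h0] at this

end CubeSat

namespace CubeSat

/-- Prepend a coordinate. -/
def cc {n : ℕ} (a : ZMod 2) (x : Fin n → ZMod 2) : Fin (n + 1) → ZMod 2 := Fin.cons a x

/-- Hamming weight. -/
def wt {n : ℕ} (x : Fin n → ZMod 2) : ℕ := ∑ i, (x i).val

lemma cc_inj {n : ℕ} {a b : ZMod 2} {x y : Fin n → ZMod 2} :
    cc a x = cc b y ↔ a = b ∧ x = y := by
  unfold cc
  exact Fin.cons_inj

lemma exists_cc {n : ℕ} (v : Fin (n + 1) → ZMod 2) : ∃ a x, v = cc a x :=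
  ⟨v 0, Fin.tail v, (Fin.cons_self_tail v).symm⟩

lemma cc_injective {n : ℕ} (a : ZMod 2) : Function.Injective (cc (n := n) a) :=
  fun _ _ h => (cc_inj.1 h).2

lemma zero_eq_cc (n : ℕ) : (0 : Fin (n + 1) → ZMod 2) = cc 0 0 := by
  funext i
  refine Fin.cases ?_ (fun j => ?_) i <;> simp [cc]

lemma z2 (a : ZMod 2) : a = 0 ∨ a = 1 := by
  revert a; decide

lemma wt_cc {n : ℕ} (a : ZMod 2) (x : Fin n → ZMod 2) : wt (cc a x) = a.val + wt x := by
  simp [wt, cc, Fin.sum_univ_succ]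

lemma wt_cc0 {n : ℕ} (x : Fin n → ZMod 2) : wt (cc 0 x) = wt x := by
  simp [wt_cc]

lemma wt_cc1 {n : ℕ} (x : Fin n → ZMod 2) : wt (cc 1 x) = wt x + 1 := by
  rw [wt_cc, ZMod.val_one, add_comm]

lemma wt_le {n : ℕ} (x : Fin n → ZMod 2) : wt x ≤ n := by
  induction n with
  | zero => simp [wt]
  | succ n ih =>
    obtain ⟨a, y, rfl⟩ := exists_cc x
    have := ih y
    rcases z2 a with rfl | rfl
    · rw [wt_cc0]; omega
    · rw [wt_cc1]; omega

lemma exists_wt (n j : ℕ) (h : j ≤ n) : ∃ x : Fin n → ZMod 2, wt x = j := by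
  induction n generalizing j with
  | zero => exact ⟨0, by simp [wt]; omega⟩
  | succ n ih =>
    cases j with
    | zero => exact ⟨0, by simp [wt]⟩
    | succ j =>
      obtain ⟨x, hx⟩ := ih j (by omega)
      exact ⟨cc 1 x, by rw [wt_cc1, hx]⟩

lemma wt_eq_zero {n : ℕ} {x : Fin n → ZMod 2} (h : wt x = 0) : x = 0 := by
  funext i
  have := (Finset.sum_eq_zero_iff.1 h) i (Finset.mem_univ i)
  simpa using this

lemma cube_adj {n : ℕ} {u v : Fin n → ZMod 2} :
    (cube n).Adj u v ↔ ∃ i, u i ≠ v i ∧ ∀ j, j ≠ i → u j = v j := by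
  unfold cube
  rw [SimpleGraph.fromRel_adj]
  constructor
  · rintro ⟨-, ⟨i, h1, h2⟩ | ⟨i, h1, h2⟩⟩
    · exact ⟨i, h1, h2⟩
    · exact ⟨i, h1.symm, fun j hj => (h2 j hj).symm⟩
  · rintro ⟨i, h1, h2⟩
    exact ⟨fun h => h1 (by rw [h]), Or.inl ⟨i, h1, h2⟩⟩

lemma cube_cc {n : ℕ} {a b : ZMod 2} {x y : Fin n → ZMod 2} :
    (cube (n + 1)).Adj (cc a x) (cc b y) ↔ (a = b ∧ (cube n).Adj x y) ∨ (a ≠ b ∧ x = y) := by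
  rw [cube_adj, cube_adj]
  constructor
  · rintro ⟨i, h1, h2⟩
    induction i using Fin.cases with
    | zero =>
      right
      refine ⟨by simpa [cc] using h1, funext fun j => ?_⟩
      simpa [cc] using h2 j.succ (Fin.succ_ne_zero j)
    | succ i =>
      left
      refine ⟨by simpa [cc] using h2 0 (Fin.succ_ne_zero i).symm, i, by simpa [cc] using h1, ?_⟩
      intro j hj
      simpa [cc] using h2 j.succ (by simpa using hj)
  · rintro (⟨rfl, i, h1, h2⟩ | ⟨hab, rfl⟩)
    · refine ⟨i.succ, by simpa [cc] using h1, ?_⟩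
      intro j
      induction j using Fin.cases with
      | zero => intro _; simp [cc]
      | succ j => intro hj; simpa [cc] using h2 j (by simpa using hj)
    · refine ⟨0, by simpa [cc] using hab, ?_⟩
      intro j
      induction j using Fin.cases with
      | zero => intro h; exact absurd rfl h
      | succ j => intro _; simp [cc]

lemma cube_parity {n : ℕ} {x y : Fin n → ZMod 2} (h : (cube n).Adj x y) :
    Even (wt x) ↔ ¬ Even (wt y) := by
  induction n with
  | zero => obtain ⟨i, -⟩ := cube_adj.1 h; exact i.elim0
  | succ n ih =>
    obtain ⟨a, x, rfl⟩ := exists_cc x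
    obtain ⟨b, y, rfl⟩ := exists_cc y
    rcases cube_cc.1 h with ⟨rfl, h'⟩ | ⟨hab, rfl⟩
    · have := ih h'
      rw [wt_cc, wt_cc, Nat.even_add, Nat.even_add]
      tauto
    · rcases z2 a with rfl | rfl <;> rcases z2 b with rfl | rfl
      · exact absurd rfl hab
      · rw [wt_cc0, wt_cc1, Nat.even_add_one, not_not]
      · rw [wt_cc0, wt_cc1, Nat.even_add_one]
      · exact absurd rfl hab

open Classical in
/-- The parent function of the binomial tree. -/
noncomputable def par : (n : ℕ) → (Fin n → ZMod 2) → (Fin n → ZMod 2)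
  | 0, x => x
  | n + 1, x => if Fin.tail x = 0 then 0 else cc (x 0) (par n (Fin.tail x))

/-- The binomial tree. -/
noncomputable def bt (n : ℕ) : SimpleGraph (Fin n → ZMod 2) :=
  SimpleGraph.fromRel (fun u v => v = par n u)

lemma par_cc0 {n : ℕ} (a : ZMod 2) : par (n + 1) (cc a 0) = 0 := by
  simp [par, cc]

lemma par_cc {n : ℕ} (a : ZMod 2) {x : Fin n → ZMod 2} (hx : x ≠ 0) :
    par (n + 1) (cc a x) = cc a (par n x) := by
  simp [par, cc, hx]

lemma par_zero (n : ℕ) : par n 0 = 0 := by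
  cases n with
  | zero => rfl
  | succ n => rw [zero_eq_cc, par_cc0, zero_eq_cc]

lemma bt_adj {n : ℕ} {u v : Fin n → ZMod 2} :
    (bt n).Adj u v ↔ u ≠ v ∧ (v = par n u ∨ u = par n v) := by
  unfold bt
  rw [SimpleGraph.fromRel_adj]

lemma bt_cc {n : ℕ} (a : ZMod 2) {x y : Fin n → ZMod 2} (h : (bt n).Adj x y) :
    (bt (n + 1)).Adj (cc a x) (cc a y) := by
  rw [bt_adj] at h ⊢
  obtain ⟨hne, h⟩ := h
  refine ⟨fun h => hne (cc_inj.1 h).2, ?_⟩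
  rcases h with h | h
  · left
    rw [par_cc, h]
    rintro rfl
    exact hne (by rw [h, par_zero])
  · right
    rw [par_cc, h]
    rintro rfl
    exact hne (by rw [h, par_zero])

lemma bt_rung (n : ℕ) : (bt (n + 1)).Adj (cc 0 0) (cc 1 0) := by
  rw [bt_adj]
  refine ⟨fun h => zero_ne_one (cc_inj.1 h).1, Or.inr ?_⟩
  rw [par_cc0, zero_eq_cc]

lemma cube_par {n : ℕ} {x : Fin n → ZMod 2} (h : x ≠ par n x) : (cube n).Adj x (par n x) := by
  induction n with
  | zero => exact absurd rfl h
  | succ n ih =>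
    obtain ⟨a, x, rfl⟩ := exists_cc x
    by_cases hx : x = 0
    · subst hx
      rw [par_cc0, zero_eq_cc] at h ⊢
      rw [cube_cc]
      exact Or.inr ⟨fun ha => h (by rw [ha]), rfl⟩
    · rw [par_cc _ hx] at h ⊢
      rw [cube_cc]
      exact Or.inl ⟨rfl, ih fun hx => h (by rw [← hx])⟩

lemma bt_le (n : ℕ) : bt n ≤ cube n := by
  intro u v h
  rw [bt_adj] at h
  obtain ⟨hne, rfl | rfl⟩ := h
  · exact cube_par hne
  · exact (cube_par hne.symm).symm

/-- Embedding of the binomial tree as a layer. -/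
def btHom (n : ℕ) (a : ZMod 2) : bt n →g bt (n + 1) := ⟨cc a, fun h => bt_cc a h⟩

/-- Paths in the two layers joined by a rung. -/
lemma glue {n : ℕ} {H H' : SimpleGraph (Fin n → ZMod 2)} {G : SimpleGraph (Fin (n + 1) → ZMod 2)}
    {a b : ZMod 2} (hab : a ≠ b)
    (hH : ∀ x y, H.Adj x y → G.Adj (cc a x) (cc a y))
    (hH' : ∀ x y, H'.Adj x y → G.Adj (cc b x) (cc b y))
    {x y z w : Fin n → ZMod 2} {k k' : ℕ}
    (hr : G.Adj (cc a y) (cc b z)) (h : HasP H x y k) (h' : HasP H' z w k') :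
    HasP G (cc a x) (cc b w) (k + k' + 1) := by
  obtain ⟨p, hp, rfl⟩ := h
  obtain ⟨q, hq, rfl⟩ := h'
  let f : H →g G := ⟨cc a, fun h => hH _ _ h⟩
  let g : H' →g G := ⟨cc b, fun h => hH' _ _ h⟩
  have hp' := hp.map (f := f) (cc_injective a)
  have hq' := hq.map (f := g) (cc_injective b)
  refine ⟨(p.map f).append (SimpleGraph.Walk.cons hr (q.map g)), ?_, ?_⟩
  · rw [SimpleGraph.Walk.isPath_def] at hp' hq' ⊢
    rw [SimpleGraph.Walk.support_append, SimpleGraph.Walk.support_cons, List.tail_cons,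
      List.nodup_append]
    refine ⟨hp', hq', ?_⟩
    intro u hu v hv huv
    rw [SimpleGraph.Walk.support_map, List.mem_map] at hu hv
    obtain ⟨u, -, rfl⟩ := hu
    obtain ⟨v, -, rfl⟩ := hv
    exact hab (cc_inj.1 huv).1
  · simp; omega

lemma bt_root {n : ℕ} (x : Fin n → ZMod 2) : HasP (bt n) 0 x (wt x) := by
  induction n with
  | zero =>
    have : x = 0 := Subsingleton.elim _ _
    subst this
    exact ⟨SimpleGraph.Walk.nil, by simp, by simp [wt]⟩
  | succ n ih =>
    obtain ⟨a, x, rfl⟩ := exists_cc x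
    rw [zero_eq_cc]
    rcases z2 a with rfl | rfl
    · rw [wt_cc0]
      exact (ih x).map (btHom n 0) (cc_injective 0)
    · rw [wt_cc1]
      have h0 : HasP (bt n) 0 0 0 := ⟨SimpleGraph.Walk.nil, by simp, by simp⟩
      have := glue (zero_ne_one) (fun x y h => bt_cc 0 h) (fun x y h => bt_cc 1 h)
        (bt_rung n) h0 (ih x)
      simpa using this

lemma bt_cross {n : ℕ} (x y : Fin n → ZMod 2) :
    HasP (bt (n + 1)) (cc 0 x) (cc 1 y) (wt x + wt y + 1) :=
  glue (zero_ne_one) (fun x y h => bt_cc 0 h) (fun x y h => bt_cc 1 h)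
        (bt_rung n) (bt_root x).symm (bt_root y)

lemma bt_layer {n : ℕ} (a : ZMod 2) {x y : Fin n → ZMod 2} {k : ℕ} (h : HasP (bt n) x y k) :
    HasP (bt (n + 1)) (cc a x) (cc a y) k :=
  h.map (btHom n a) (cc_injective a)

lemma bt_connected (n : ℕ) : (bt n).Connected := by
  refine ⟨fun x y => ?_⟩
  obtain ⟨p, -⟩ := bt_root x
  obtain ⟨q, -⟩ := bt_root y
  exact p.reachable.symm.trans q.reachable

lemma bt_edges_le (n : ℕ) : (bt n).edgeSet.ncard ≤ 2 ^ n - 1 := by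
  have hsub : (bt n).edgeSet ⊆ (fun v => s(v, par n v)) '' {v | v ≠ 0} := by
    intro e
    induction e using Sym2.ind with
    | _ u v =>
      intro h
      rw [SimpleGraph.mem_edgeSet, bt_adj] at h
      obtain ⟨hne, rfl | rfl⟩ := h
      · refine ⟨u, ?_, rfl⟩
        rintro rfl
        exact hne (par_zero n).symm
      · refine ⟨v, ?_, Sym2.eq_swap⟩
        rintro rfl
        exact hne (par_zero n)
  refine (Set.ncard_le_ncard hsub (Set.toFinite _)).trans ?_
  refine (Set.ncard_image_le (Set.toFinite _)).trans ?_
  have : {v : Fin n → ZMod 2 | v ≠ 0} = {0}ᶜ := rfl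
  rw [this, Set.ncard_compl, Set.ncard_singleton]
  simp

lemma edges_ge {n : ℕ} {G : SimpleGraph (Fin n → ZMod 2)} (h : G.Connected) :
    2 ^ n - 1 ≤ G.edgeSet.ncard := by
  have := h.card_vert_le_card_edgeSet_add_one
  rw [Nat.card_coe_set_eq] at this
  simp at this
  omega

lemma bt_edges (n : ℕ) : (bt n).edgeSet.ncard = 2 ^ n - 1 :=
  le_antisymm (bt_edges_le n) (edges_ge (bt_connected n))

lemma bt_tree (n : ℕ) : (bt n).IsTree := by
  rw [SimpleGraph.isTree_iff_connected_and_card]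
  refine ⟨bt_connected n, ?_⟩
  rw [Nat.card_coe_set_eq, bt_edges]
  have : 0 < 2 ^ n := by positivity
  simp
  omega

/-- A set of vertices closed under tree distance `n` and containing `0` contains all vertices
of even weight. -/
lemma even_mem {n : ℕ} (R : (Fin n → ZMod 2) → Prop) (h0 : R 0)
    (hR : ∀ x y, HasP (bt n) x y n → R x → R y) (x : Fin n → ZMod 2) (hx : Even (wt x)) : R x := by
  cases n with
  | zero => rwa [Subsingleton.elim x 0]
  | succ m =>
    -- weights in the tail, `m + 1 = n`
    have hca : ∀ y z : Fin m → ZMod 2, wt y + wt z = m → R (cc 0 y) → R (cc 1 z) := by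
      intro y z h
      refine hR _ _ ?_
      have := bt_cross y z
      rwa [h] at this
    have hac : ∀ y z : Fin m → ZMod 2, wt y + wt z = m → R (cc 1 z) → R (cc 0 y) := by
      intro y z h
      refine hR _ _ ?_
      have := (bt_cross y z).symm
      rwa [h] at this
    -- links inside a layer
    have hlink : ∀ (a : ZMod 2) (i j : ℕ), i + j = m + 1 → 1 ≤ i → 1 ≤ j →
        (∀ y : Fin m → ZMod 2, wt y = i → R (cc a y)) →
        ∃ y : Fin m → ZMod 2, wt y = j ∧ R (cc a y) := by
      intro a i j hij hi hj h
      obtain ⟨m, rfl⟩ : ∃ m', m = m' + 1 := ⟨m - 1, by omega⟩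
      rcases lt_trichotomy i j with hlt | rfl | hlt
      · obtain ⟨y, hy⟩ := exists_wt m i (by omega)
        obtain ⟨z, hz⟩ := exists_wt m (j - 1) (by omega)
        refine ⟨cc 1 z, by rw [wt_cc1]; omega, ?_⟩
        refine hR _ _ ?_ (h (cc 0 y) (by rw [wt_cc0, hy]))
        have := bt_layer a (bt_cross y z)
        rwa [show wt y + wt z + 1 = m + 1 + 1 by omega] at this
      · obtain ⟨y, hy⟩ := exists_wt (m + 1) i (by omega)
        exact ⟨y, hy, h y hy⟩
      · obtain ⟨y, hy⟩ := exists_wt m j (by omega)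
        obtain ⟨z, hz⟩ := exists_wt m (i - 1) (by omega)
        refine ⟨cc 0 y, by rw [wt_cc0]; omega, ?_⟩
        refine hR _ _ ?_ (h (cc 1 z) (by rw [wt_cc1]; omega))
        have := (bt_layer a (bt_cross y z)).symm
        rwa [show wt y + wt z + 1 = m + 1 + 1 by omega] at this
    have second : ∀ k, 2 * k ≤ m → (∀ y : Fin m → ZMod 2, wt y = 2 * k → R (cc 0 y)) →
        (∀ z : Fin m → ZMod 2, wt z + 2 * k = m → R (cc 1 z)) := by
      intro k hk h z hz
      obtain ⟨y, hy⟩ := exists_wt m (2 * k) hk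
      exact hca y z (by omega) (h y hy)
    have third : ∀ k, 2 * k + 1 ≤ m → (∀ z : Fin m → ZMod 2, wt z + 2 * k = m → R (cc 1 z)) →
        ∀ z : Fin m → ZMod 2, wt z = 2 * k + 1 → R (cc 1 z) := by
      intro k hk h z hz
      obtain ⟨y, hy, hRy⟩ := hlink 1 (m - 2 * k) (2 * k + 1) (by omega) (by omega) (by omega)
        (fun y hy => h y (by omega))
      obtain ⟨w, hw⟩ := exists_wt m (m - 2 * k - 1) (by omega)
      exact hca w z (by omega) (hac w y (by omega) hRy)
    have first : ∀ k, 2 * k ≤ m → ∀ y : Fin m → ZMod 2, wt y = 2 * k → R (cc 0 y) := by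
      intro k
      induction k with
      | zero =>
        intro hk y hy
        rw [wt_eq_zero hy, ← zero_eq_cc]
        exact h0
      | succ k ih =>
        intro hk y hy
        have ih' := third k (by omega) (second k (by omega) (ih (by omega)))
        obtain ⟨u, hu, hRu⟩ := hlink 0 (m - 2 * k - 1) (2 * (k + 1)) (by omega) (by omega)
          (by omega) (fun u hu => by
            obtain ⟨z, hz⟩ := exists_wt m (2 * k + 1) (by omega)
            exact hac u z (by omega) (ih' z hz))
        obtain ⟨z, hz⟩ := exists_wt m (m - 2 * (k + 1)) (by omega)
        exact hac y z (by omega) (hca u z (by omega) hRu)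
    obtain ⟨a, y, rfl⟩ := exists_cc x
    have hy := wt_le y
    rcases z2 a with rfl | rfl
    · rw [wt_cc0] at hx
      obtain ⟨k, hk⟩ := hx
      exact first k (by omega) y (by omega)
    · rw [wt_cc1] at hx
      obtain ⟨k, hk⟩ := hx
      exact third (k - 1) (by omega) (second _ (by omega) (first _ (by omega))) y (by omega)

end CubeSat

namespace CubeSat

/-- Lifting a path of a layer using two rungs among even vertices. -/
lemma lift_path {n : ℕ} {H : SimpleGraph (Fin n → ZMod 2)} {G : SimpleGraph (Fin (n + 1) → ZMod 2)}
    (hcube : H ≤ cube n) {a b : ZMod 2} (hab : a ≠ b)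
    (ha : ∀ x y, H.Adj x y → G.Adj (cc a x) (cc a y))
    (hb : ∀ x y, H.Adj x y → G.Adj (cc b x) (cc b y))
    (hr : ∀ x, Even (wt x) → G.Adj (cc a x) (cc b x))
    {x y : Fin n → ZMod 2} {k : ℕ} (h : HasP H x y (k + 3)) :
    HasP G (cc a x) (cc a y) (k + 5) := by
  obtain ⟨p, hp, hk⟩ := h
  let f : H →g G := ⟨cc a, fun h => ha _ _ h⟩
  have hf : Function.Injective f := cc_injective a
  have hcc : ∀ u v : Fin n → ZMod 2, cc a u ≠ cc b v := fun u v h => hab (cc_inj.1 h).1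
  have hcc' : ∀ u v : Fin n → ZMod 2, cc b u ≠ cc a v := fun u v h => hab (cc_inj.1 h).1.symm
  have hmem : ∀ (z w : Fin n → ZMod 2) (u : Fin n → ZMod 2) (q : H.Walk z w),
      (cc a u ∈ (q.map f).support ↔ u ∈ q.support) := by
    intro z w u q
    rw [SimpleGraph.Walk.support_map]
    exact List.mem_map_of_injective hf
  have hmem' : ∀ (z w : Fin n → ZMod 2) (u : Fin n → ZMod 2) (q : H.Walk z w),
      ¬ (cc b u ∈ (q.map f).support) := by
    intro z w u q h
    rw [SimpleGraph.Walk.support_map, List.mem_map] at h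
    obtain ⟨v, -, hv⟩ := h
    exact hcc _ _ hv
  have hmap : ∀ (z w : Fin n → ZMod 2) (q : H.Walk z w), q.IsPath → (q.map f).IsPath :=
    fun z w q hq => hq.map hf
  cases p with
  | nil => simp at hk
  | @cons _ w1 _ h1 p =>
  cases p with
  | nil => simp at hk
  | @cons _ w2 _ h2 p =>
  cases p with
  | nil => simp at hk
  | @cons _ w3 _ h3 p =>
  simp only [SimpleGraph.Walk.length_cons] at hk
  simp only [SimpleGraph.Walk.cons_isPath_iff, SimpleGraph.Walk.support_cons, List.mem_cons,
    not_or] at hp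
  obtain ⟨⟨⟨hp1, hp2⟩, hp3, hp4⟩, hp5, hp6, hp7⟩ := hp
  have hs := p.start_mem_support
  have hp8 : w1 ≠ w3 := fun h => hp4 (h ▸ hs)
  have hp9 : w2 ≠ w3 := fun h => hp2 (h ▸ hs)
  have hp10 : x ≠ w3 := fun h => hp7 (h ▸ hs)
  have e1 := cube_parity (hcube h1)
  have e2 := cube_parity (hcube h2)
  have e3 := cube_parity (hcube h3)
  by_cases hx : Even (wt x)
  · have hw2 : Even (wt w2) := by tauto
    refine ⟨SimpleGraph.Walk.cons (hr x hx) (SimpleGraph.Walk.cons (hb _ _ h1)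
      (SimpleGraph.Walk.cons (hb _ _ h2) (SimpleGraph.Walk.cons (hr w2 hw2).symm
      (SimpleGraph.Walk.cons (ha _ _ h3) (p.map f))))), ?_, ?_⟩
    · have hm := hmap _ _ p hp1
      simp only [SimpleGraph.Walk.cons_isPath_iff, SimpleGraph.Walk.support_cons, List.mem_cons,
        not_or]
      simp only [hmem, hmem', cc_inj, hab, hab.symm, false_and, true_and, not_false_eq_true,
        and_true]
      tauto
    · simp; omega
  · have hw1 : Even (wt w1) := by tauto
    have hw3 : Even (wt w3) := by tauto
    refine ⟨SimpleGraph.Walk.cons (ha _ _ h1) (SimpleGraph.Walk.cons (hr w1 hw1)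
      (SimpleGraph.Walk.cons (hb _ _ h2) (SimpleGraph.Walk.cons (hb _ _ h3)
      (SimpleGraph.Walk.cons (hr w3 hw3).symm (p.map f))))), ?_, ?_⟩
    · have hm := hmap _ _ p hp1
      simp only [SimpleGraph.Walk.cons_isPath_iff, SimpleGraph.Walk.support_cons, List.mem_cons,
        not_or]
      simp only [hmem, hmem', cc_inj, hab, hab.symm, false_and, true_and, not_false_eq_true,
        and_true]
      tauto
    · simp; omega

/-- Every vertex of the cube lies on an edge contained in a cycle of length `2n`. -/
lemma cube_long (n : ℕ) (x : Fin (n + 1) → ZMod 2) :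
    ∃ z, (cube (n + 1)).Adj x z ∧ HasP (cube (n + 1)) x z (2 * n + 1) := by
  induction n with
  | zero =>
    obtain ⟨a, x, rfl⟩ := exists_cc x
    have h : (cube (0 + 1)).Adj (cc a x) (cc (a + 1) x) := by
      rw [cube_cc]
      right
      exact ⟨by revert a; decide, rfl⟩
    exact ⟨_, h, SimpleGraph.Walk.cons h SimpleGraph.Walk.nil, by simp [h.ne], by simp⟩
  | succ n ih =>
    obtain ⟨a, x, rfl⟩ := exists_cc x
    obtain ⟨z, hz, hp⟩ := ih x
    have hz' : (cube (n + 1 + 1)).Adj (cc a x) (cc a z) := cube_cc.2 (Or.inl ⟨rfl, hz⟩)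
    refine ⟨_, hz', ?_⟩
    have hab : a ≠ a + 1 := by clear hz'; revert a; decide
    rcases Nat.eq_zero_or_pos n with rfl | hn
    · have r1 : (cube (0 + 1 + 1)).Adj (cc a x) (cc (a + 1) x) := cube_cc.2 (Or.inr ⟨hab, rfl⟩)
      have r2 : (cube (0 + 1 + 1)).Adj (cc (a + 1) x) (cc (a + 1) z) :=
        cube_cc.2 (Or.inl ⟨rfl, hz⟩)
      have r3 : (cube (0 + 1 + 1)).Adj (cc (a + 1) z) (cc a z) :=
        cube_cc.2 (Or.inr ⟨hab.symm, rfl⟩)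
      refine ⟨SimpleGraph.Walk.cons r1 (SimpleGraph.Walk.cons r2 (SimpleGraph.Walk.cons r3
        SimpleGraph.Walk.nil)), ?_, by simp⟩
      simp [cc_inj, hz.ne]
    · have := lift_path (H := cube (n + 1)) (G := cube (n + 1 + 1)) le_rfl hab
        (fun x y h => cube_cc.2 (Or.inl ⟨rfl, h⟩)) (fun x y h => cube_cc.2 (Or.inl ⟨rfl, h⟩))
        (fun x _ => cube_cc.2 (Or.inr ⟨hab, rfl⟩)) (k := 2 * n - 2) (x := x) (y := z)
        (by rwa [show 2 * n - 2 + 3 = 2 * n + 1 by omega])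
      rwa [show 2 * n - 2 + 5 = 2 * (n + 1) + 1 by omega] at this

lemma closed_eq (n : ℕ) (G : SimpleGraph (Fin (n + 1) → ZMod 2)) (hT : bt (n + 1) ≤ G)
    (hG : G ≤ cube (n + 1)) (hc : Closed (cube (n + 1)) G (2 * n + 1)) : G = cube (n + 1) := by
  induction n with
  | zero =>
    refine le_antisymm hG ?_
    intro u v h
    apply hT
    obtain ⟨a, x, rfl⟩ := exists_cc u
    obtain ⟨b, y, rfl⟩ := exists_cc v
    obtain rfl : x = 0 := Subsingleton.elim _ _
    obtain rfl : y = 0 := Subsingleton.elim _ _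
    rcases z2 a with rfl | rfl <;> rcases z2 b with rfl | rfl
    · exact absurd rfl h.ne
    · exact bt_rung 0
    · exact (bt_rung 0).symm
    · exact absurd rfl h.ne
  | succ n ih =>
    let H : SimpleGraph (Fin (n + 1) → ZMod 2) :=
      { Adj := fun x y => G.Adj (cc 0 x) (cc 0 y) ∧ G.Adj (cc 1 x) (cc 1 y)
        symm := ⟨fun x y h => ⟨h.1.symm, h.2.symm⟩⟩
        loopless := ⟨fun x h => G.loopless.irrefl _ h.1⟩ }
    have hH0 : ∀ x y, H.Adj x y → G.Adj (cc 0 x) (cc 0 y) := fun x y h => h.1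
    have hH1 : ∀ x y, H.Adj x y → G.Adj (cc 1 x) (cc 1 y) := fun x y h => h.2
    have hHcube : H ≤ cube (n + 1) := by
      intro x y h
      rcases cube_cc.1 (hG h.1) with h | h
      · exact h.2
      · exact absurd rfl h.1
    have hTH : bt (n + 1) ≤ H := fun x y h => ⟨hT (bt_cc 0 h), hT (bt_cc 1 h)⟩
    let R : (Fin (n + 1) → ZMod 2) → Prop := fun x => G.Adj (cc 0 x) (cc 1 x)
    have hRstep : ∀ x y k k', k + k' = 2 * (n + 1) → HasP H x y k → HasP H x y k' → R x → R y := by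
      intro x y k k' hk h h' hx
      refine hc _ _ (cube_cc.2 (Or.inr ⟨zero_ne_one, rfl⟩)) ?_
      have := glue zero_ne_one hH0 hH1 hx h.symm h'
      rwa [hk] at this
    have hReven : ∀ x, Even (wt x) → R x := by
      refine even_mem R (hT (bt_rung _)) ?_
      intro x y hp
      have hp' : HasP H x y (n + 1) :=
        hp.map (SimpleGraph.Hom.ofLE hTH) (fun _ _ h => h)
      exact hRstep x y _ _ (by omega) hp' hp'
    have hHeq : H = cube (n + 1) := by
      refine ih H hTH hHcube ?_
      intro x y hxy hp
      rcases Nat.eq_zero_or_pos n with rfl | hn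
      · obtain ⟨p, -, hp⟩ := hp
        exact SimpleGraph.Walk.adj_of_length_eq_one hp
      · have hp' : HasP H x y (2 * n - 2 + 3) := by
          rwa [show 2 * n - 2 + 3 = 2 * n + 1 by omega]
        constructor
        · refine hc _ _ (cube_cc.2 (Or.inl ⟨rfl, hxy⟩)) ?_
          have := lift_path hHcube zero_ne_one hH0 hH1 hReven hp'
          rwa [show 2 * n - 2 + 5 = 2 * (n + 1) + 1 by omega] at this
        · refine hc _ _ (cube_cc.2 (Or.inl ⟨rfl, hxy⟩)) ?_
          have := lift_path hHcube one_ne_zero hH1 hH0 (fun x hx => (hReven x hx).symm) hp'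
          rwa [show 2 * n - 2 + 5 = 2 * (n + 1) + 1 by omega] at this
    have hRall : ∀ x, R x := by
      intro x
      by_cases hx : Even (wt x)
      · exact hReven x hx
      · obtain ⟨z, hz, hp⟩ := cube_long n x
        have hz' : Even (wt z) := by
          have := cube_parity hz
          tauto
        rw [← hHeq] at hz hp
        have h1 : HasP H x z 1 :=
          ⟨SimpleGraph.Walk.cons hz SimpleGraph.Walk.nil, by simp [hz.ne], by simp⟩
        exact hRstep z x 1 (2 * n + 1) (by omega) h1.symm hp.symm (hReven z hz')
    refine le_antisymm hG ?_
    intro u v h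
    obtain ⟨a, x, rfl⟩ := exists_cc u
    obtain ⟨b, y, rfl⟩ := exists_cc v
    rcases cube_cc.1 h with ⟨rfl, h'⟩ | ⟨hab, rfl⟩
    · rw [← hHeq] at h'
      rcases z2 a with rfl | rfl
      · exact h'.1
      · exact h'.2
    · rcases z2 a with rfl | rfl <;> rcases z2 b with rfl | rfl
      · exact absurd rfl hab
      · exact hRall x
      · exact (hRall x).symm
      · exact absurd rfl hab

end CubeSat

theorem stmt_17 (l : ℕ) (hl : 2 ≤ l) :
    (∃ T : SimpleGraph (Fin l → ZMod 2), T ≤ cube l ∧ T.IsTree ∧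
      WeaklySaturated (cube l) T (cycleGraph (2 * l))) ∧
    wsatNum (cube l) (cycleGraph (2 * l)) = 2 ^ l - 1 := by
  have hws : WeaklySaturated (cube l) (CubeSat.bt l) (cycleGraph (2 * l)) := by
    obtain ⟨n, rfl⟩ : ∃ n, l = n + 1 := ⟨l - 1, by omega⟩
    refine CubeSat.ws_of_closed hl ?_ (CubeSat.bt_le _)
    intro G hT hG hc
    exact CubeSat.closed_eq n G hT hG hc
  refine ⟨⟨CubeSat.bt l, CubeSat.bt_le l, CubeSat.bt_tree l, hws⟩, ?_⟩
  refine le_antisymm (Nat.sInf_le ⟨_, hws, CubeSat.bt_edges l⟩) ?_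
  refine le_csInf ⟨_, _, hws, rfl⟩ ?_
  rintro m ⟨G, hG, rfl⟩
  exact CubeSat.edges_ge (CubeSat.connected_of_ws hl
    ((CubeSat.bt_connected l).mono (CubeSat.bt_le l)) hG)
end
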